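/- Let K be a field of characteristic 0 and let A be a differential graded algebra over K. If the product on the cohomology algebra H(A) induced by the multiplication of A is identically zero, and for every n ≥ 3 and every tuple of cohomology classes x₁, …, xₙ ∈ H(A) for which the Massey n-product ⟨x₁, …, xₙ⟩ is defined the Massey n-product vanishes (i.e. contains the zero class), then A is formal. -/

import Mathlib

/-! # Background definitions: graded vector spaces, `A∞`-algebras, dg-algebras,
Massey products, formality (following the conventions of the paper). -/

open scoped DirectSum

/-- A `ℤ`-graded vector space over `K`: a vector space together with a family of
subspaces indexed by `ℤ` into which it decomposes as a direct sum. -/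
structure GVS (K : Type) [Field K] where
  carrier : Type
  [acg : AddCommGroup carrier]
  [mod : Module K carrier]
  grading : ℤ → Submodule K carrier
  decomp : DirectSum.Decomposition grading

attribute [instance] GVS.acg GVS.mod

/-- A family of candidate `A∞`-operations on a graded vector space `V`:
`K`-multilinear maps `op n : V^{⊗ n} → V` of degree `2 - n`. -/
structure AInftyStr (K : Type) [Field K] (V : GVS K) where
  op : (n : ℕ) → MultilinearMap K (fun _ : Fin n => V.carrier) V.carrier
  op_degree : ∀ (n : ℕ) (e : Fin n → ℤ) (a : Fin n → V.carrier),
    (∀ i, a i ∈ V.grading (e i)) →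
    op n a ∈ V.grading ((∑ i, e i) + (2 - (n : ℤ)))

namespace AInftyStr

variable {K : Type} [Field K] {V : GVS K}

/-- The unary operation `m₁`, the candidate differential. -/
def d (m : AInftyStr K V) (x : V.carrier) : V.carrier :=
  m.op 1 (fun _ => x)

/-- The `n`-th Stasheff identity
`∑_{r+s+t=n} (-1)^{r+st} m_{r+1+t} (Id^{⊗r} ⊗ m_s ⊗ Id^{⊗t}) = 0`,
written out elementwise on homogeneous elements (the Koszul sign
`(-1)^{(2-s)(|a₁|+⋯+|a_r|)} = (-1)^{s(|a₁|+⋯+|a_r|)}` appears when evaluating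
`Id^{⊗r} ⊗ m_s ⊗ Id^{⊗t}` on elements). -/
def Stasheff (m : AInftyStr K V) (n : ℕ) : Prop :=
  ∀ (e : ℕ → ℤ) (a : ℕ → V.carrier), (∀ i, a i ∈ V.grading (e i)) →
    ∑ r ∈ Finset.range n, ∑ s ∈ Finset.Icc 1 (n - r),
      ((-1 : K) ^ ((r : ℤ) + (s : ℤ) * ((n : ℤ) - (r : ℤ) - (s : ℤ))
          + (s : ℤ) * ∑ i ∈ Finset.range r, e i)) •
        m.op (r + 1 + (n - r - s)) (fun j : Fin (r + 1 + (n - r - s)) =>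
          if (j : ℕ) < r then a j
          else if (j : ℕ) = r then m.op s (fun i : Fin s => a (r + (i : ℕ)))
          else a ((j : ℕ) + s - 1)) = 0

end AInftyStr

/-- An `A∞`-algebra over `K`: a graded vector space with multilinear operations
of degree `2 - n` satisfying all Stasheff identities. -/
structure AInftyAlg (K : Type) [Field K] where
  V : GVS K
  str : AInftyStr K V
  stasheff : ∀ n, 1 ≤ n → str.Stasheff n

/-- The data of an `A∞`-morphism between graded vector spaces equipped with
operations: multilinear maps `f n : V^{⊗n} → W` of degree `1 - n`. -/
structure AInftyHomData (K : Type) [Field K] (V W : GVS K) where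
  f : (n : ℕ) → MultilinearMap K (fun _ : Fin n => V.carrier) W.carrier
  f_degree : ∀ (n : ℕ) (e : Fin n → ℤ) (a : Fin n → V.carrier),
    (∀ i, a i ∈ V.grading (e i)) →
    f n a ∈ W.grading ((∑ i, e i) + (1 - (n : ℤ)))

namespace AInftyHomData

variable {K : Type} [Field K] {V W : GVS K}

/-- The linear component `f₁` of an `A∞`-morphism. -/
def f1 (φ : AInftyHomData K V W) (x : V.carrier) : W.carrier :=
  φ.f 1 (fun _ => x)

/-- The `n`-th `A∞`-morphism equation
`∑_{r+s+t=n} (-1)^{r+st} f_{r+1+t}(id^{⊗r} ⊗ m_s ⊗ id^{⊗t})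
  = ∑_k ∑_{i₁+⋯+i_k=n} (-1)^{u_k} m_k (f_{i₁} ⊗ ⋯ ⊗ f_{i_k})`,
with `u_k = ∑_{t=1}^{k-1} t (i_{k-t} - 1)`, written out elementwise on
homogeneous elements (including the Koszul signs coming from evaluating tensor
products of graded maps on elements). -/
def Eqn (φ : AInftyHomData K V W) (mV : AInftyStr K V) (mW : AInftyStr K W)
    (n : ℕ) : Prop :=
  ∀ (e : ℕ → ℤ) (a : ℕ → V.carrier), (∀ i, a i ∈ V.grading (e i)) →
    (∑ r ∈ Finset.range n, ∑ s ∈ Finset.Icc 1 (n - r),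
      ((-1 : K) ^ ((r : ℤ) + (s : ℤ) * ((n : ℤ) - (r : ℤ) - (s : ℤ))
          + (s : ℤ) * ∑ i ∈ Finset.range r, e i)) •
        φ.f (r + 1 + (n - r - s)) (fun j : Fin (r + 1 + (n - r - s)) =>
          if (j : ℕ) < r then a j
          else if (j : ℕ) = r then mV.op s (fun i : Fin s => a (r + (i : ℕ)))
          else a ((j : ℕ) + s - 1)))
    =
    ∑ c : Composition n,
      ((-1 : K) ^ ((∑ j : Fin c.length,
            ((c.length : ℤ) - 1 - (j : ℤ)) * ((c.blocksFun j : ℤ) - 1))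
          + ∑ j : Fin c.length,
            (1 - (c.blocksFun j : ℤ)) * ∑ i ∈ Finset.range (c.sizeUpTo (j : ℕ)), e i)) •
        mW.op c.length (fun j : Fin c.length =>
          φ.f (c.blocksFun j) (fun i : Fin (c.blocksFun j) =>
            a (c.sizeUpTo (j : ℕ) + (i : ℕ))))

/-- `φ` is a quasi-isomorphism: its linear part `f₁` induces an isomorphism on
cohomology (injectivity and surjectivity of the induced map, spelled out). -/
def IsQuasiIso (φ : AInftyHomData K V W) (mV : AInftyStr K V) (mW : AInftyStr K W) : Prop :=
  (∀ x, mV.d x = 0 → (∃ c, φ.f1 x = mW.d c) → ∃ c, x = mV.d c) ∧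
  (∀ y, mW.d y = 0 → ∃ x, mV.d x = 0 ∧ ∃ c, y - φ.f1 x = mW.d c)

end AInftyHomData

/-- `φ` is an `A∞`-morphism from `(V, mV)` to `(W, mW)`: all morphism equations hold. -/
def IsAInftyMorphism {K : Type} [Field K] {V W : GVS K} (φ : AInftyHomData K V W)
    (mV : AInftyStr K V) (mW : AInftyStr K W) : Prop :=
  ∀ n, 1 ≤ n → φ.Eqn mV mW n

/-- A dg-algebra: an `A∞`-algebra whose operations of arity `≥ 3` vanish. -/
structure DGAlg (K : Type) [Field K] where
  V : GVS K
  str : AInftyStr K V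
  stasheff : ∀ n, 1 ≤ n → str.Stasheff n
  higher : ∀ n, 3 ≤ n → str.op n = 0

namespace DGAlg

variable {K : Type} [Field K]

/-- The differential of a dg-algebra. -/
def d (A : DGAlg K) (x : A.V.carrier) : A.V.carrier := A.str.d x

/-- The product of a dg-algebra. -/
def mul (A : DGAlg K) (x y : A.V.carrier) : A.V.carrier := A.str.op 2 ![x, y]

/-- A dg-algebra is formal if it is `A∞`-quasi-isomorphic to a dg-algebra with
trivial differential. -/
def IsFormal (A : DGAlg K) : Prop :=
  ∃ B : DGAlg K, (∀ x, B.d x = 0) ∧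
    ∃ φ : AInftyHomData K B.V A.V, IsAInftyMorphism φ B.str A.str ∧
      φ.IsQuasiIso B.str A.str

end DGAlg

/-! ## Massey products -/

/-- The degree of the cochain `a i j` in a defining system for classes of degrees
`dg 0, …, dg (n-1)` (0-indexed): `|a_{i,j}| = (∑_{k=i}^{j-1} |x_k|) - (j - i - 1)`. -/
def mDeg (dg : ℕ → ℤ) (i j : ℕ) : ℤ :=
  (∑ k ∈ Finset.Ico i j, dg k) - ((j : ℤ) - (i : ℤ) - 1)

/-- A defining system for the (classes of the) cocycles `u 0, …, u (n-1)`, of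
degrees `dg 0, …, dg (n-1)`: cochains `a i j` for `0 ≤ i < j ≤ n`, `(i,j) ≠ (0,n)`,
with `a i (i+1)` representing the class of `u i`, and
`d (a i j) = ∑_{i<k<j} (-1)^{|a i k|} (a i k) * (a k j)`. -/
structure DefiningSystem {K : Type} [Field K] (A : DGAlg K) (n : ℕ)
    (dg : ℕ → ℤ) (u : ℕ → A.V.carrier) where
  a : ℕ → ℕ → A.V.carrier
  mem_grading : ∀ i j, i < j → j ≤ n → (i, j) ≠ (0, n) →
    a i j ∈ A.V.grading (mDeg dg i j)
  represents : ∀ i, i < n → ∃ c, a i (i + 1) - u i = A.d c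
  d_eq : ∀ i j, i < j → j ≤ n → (i, j) ≠ (0, n) →
    A.d (a i j) = ∑ k ∈ Finset.Ioo i j,
      A.mul (((-1 : K) ^ mDeg dg i k) • a i k) (a k j)

/-- The cocycle `∑_{0<k<n} (-1)^{|a 0 k|} (a 0 k) * (a k n)` produced by a
defining system; its class is the corresponding element of the Massey product. -/
def DefiningSystem.value {K : Type} [Field K] {A : DGAlg K} {n : ℕ}
    {dg : ℕ → ℤ} {u : ℕ → A.V.carrier} (ds : DefiningSystem A n dg u) :
    A.V.carrier :=
  ∑ k ∈ Finset.Ioo 0 n, A.mul (((-1 : K) ^ mDeg dg 0 k) • ds.a 0 k) (ds.a k n)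

/-- `u 0, …, u (n-1)` are valid representatives of cohomology classes of degrees
`dg 0, …, dg (n-1)`: homogeneous cocycles. -/
def ValidReps {K : Type} [Field K] (A : DGAlg K) (n : ℕ) (dg : ℕ → ℤ)
    (u : ℕ → A.V.carrier) : Prop :=
  ∀ i, i < n → A.d (u i) = 0 ∧ u i ∈ A.V.grading (dg i)

/-- The Massey `n`-product of the classes of `u 0, …, u (n-1)` is defined, i.e.
some defining system exists. -/
def MasseyDefined {K : Type} [Field K] (A : DGAlg K) (n : ℕ) (dg : ℕ → ℤ)
    (u : ℕ → A.V.carrier) : Prop :=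
  Nonempty (DefiningSystem A n dg u)

/-- The Massey `n`-product of the classes of `u 0, …, u (n-1)` contains the class
of the cocycle `x`. -/
def MasseyContains {K : Type} [Field K] (A : DGAlg K) (n : ℕ) (dg : ℕ → ℤ)
    (u : ℕ → A.V.carrier) (x : A.V.carrier) : Prop :=
  ∃ ds : DefiningSystem A n dg u, ∃ c, ds.value - x = A.d c

/-- The Massey `n`-product of the classes of `u 0, …, u (n-1)` vanishes, i.e.
contains the zero class. -/
def MasseyVanishes {K : Type} [Field K] (A : DGAlg K) (n : ℕ) (dg : ℕ → ℤ)
    (u : ℕ → A.V.carrier) : Prop :=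
  MasseyContains A n dg u 0

namespace TensorAlgebra

variable {K A X : Type*} [Field K] [AddCommGroup A] [Module K A] [AddCommGroup X] [Module K X]

/-- Linear maps out of a tensor algebra that agree on words built letter by letter are equal. -/
theorem linearMap_ext_cons {L L' : TensorAlgebra K A →ₗ[K] X} (h_one : L 1 = L' 1)
    (h_cons : ∀ a w, L w = L' w → L (ι K a * w) = L' (ι K a * w)) : L = L' := by
  ext w
  suffices h : ∀ v, L v = L' v → L (w * v) = L' (w * v) by simpa using h 1 h_one
  induction w using TensorAlgebra.induction with
  | algebraMap r =>
    intro v hv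
    simp [← Algebra.smul_def, hv]
  | ι a => exact fun v hv => h_cons a v hv
  | mul x y hx hy =>
    intro v hv
    rw [mul_assoc]
    exact hx _ (hy _ hv)
  | add x y hx hy =>
    intro v hv
    rw [add_mul, map_add, map_add, hx v hv, hy v hv]

/-- One letter of the recursion defining `consRec`. -/
noncomputable def consStep (step : A →ₗ[K] (TensorAlgebra K A × X) →ₗ[K] X) :
    A →ₗ[K] Module.End K (TensorAlgebra K A × X) :=
  LinearMap.mk₂ K (fun a p => (ι K a * p.1, step a p))
    (by intros; ext <;> simp [add_mul]) (by intros; ext <;> simp)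
    (by intros; ext <;> simp [mul_add]) (by intros; ext <;> simp)

/-- Definition of a linear map on the tensor algebra by recursion on the first letter. -/
noncomputable def consRec (step : A →ₗ[K] (TensorAlgebra K A × X) →ₗ[K] X) (x : X) :
    TensorAlgebra K A →ₗ[K] X :=
  LinearMap.snd K _ _ ∘ₗ LinearMap.applyₗ ((1 : TensorAlgebra K A), x) ∘ₗ
    (lift K (consStep step)).toLinearMap

@[simp]
theorem consRec_one (step : A →ₗ[K] (TensorAlgebra K A × X) →ₗ[K] X) (x : X) :
    consRec step x 1 = x := by
  simp [consRec]

theorem lift_consStep_fst (step : A →ₗ[K] (TensorAlgebra K A × X) →ₗ[K] X) (x : X)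
    (w : TensorAlgebra K A) : (lift K (consStep step) w (1, x)).1 = w := by
  have h : LinearMap.fst K _ _ ∘ₗ LinearMap.applyₗ ((1 : TensorAlgebra K A), x) ∘ₗ
      (lift K (consStep step)).toLinearMap = LinearMap.id := by
    refine linearMap_ext_cons (by simp) fun a w hw => ?_
    simpa [consStep] using congrArg (ι K a * ·) hw
  exact LinearMap.congr_fun h w

@[simp]
theorem consRec_cons (step : A →ₗ[K] (TensorAlgebra K A × X) →ₗ[K] X) (x : X) (a : A)
    (w : TensorAlgebra K A) :
    consRec step x (ι K a * w) = step a (w, consRec step x w) := by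
  have h : lift K (consStep step) w (1, x) = (w, consRec step x w) :=
    Prod.ext (lift_consStep_fst step x w) rfl
  simp only [consRec, LinearMap.comp_apply, AlgHom.toLinearMap_apply, map_mul,
    lift_ι_apply, LinearMap.applyₗ_apply_apply, Module.End.mul_apply] at h ⊢
  rw [h]
  rfl

end TensorAlgebra

/-- A differential graded algebra, with its grading remembered only through the sign involution
`x ↦ (-1)^|x| x`, together with a homotopy `h` from the identity to an idempotent `proj` whose
image represents the cohomology. -/
structure HomotopyRetract (K A : Type*) [Field K] [AddCommGroup A] [Module K A] where
  d : A →ₗ[K] A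
  sgn : A →ₗ[K] A
  mul : A →ₗ[K] A →ₗ[K] A
  proj : A →ₗ[K] A
  h : A →ₗ[K] A
  sgn_sgn : ∀ x, sgn (sgn x) = x
  sgn_d : ∀ x, sgn (d x) = -d (sgn x)
  sgn_mul : ∀ x y, sgn (mul x y) = mul (sgn x) (sgn y)
  sgn_h : ∀ x, sgn (h x) = -h (sgn x)
  sgn_proj : ∀ x, sgn (proj x) = proj (sgn x)
  d_mul : ∀ x y, d (mul x y) = mul (d x) y + mul (sgn x) (d y)
  mul_assoc : ∀ x y z, mul (mul x y) z = mul x (mul y z)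
  homotopy : ∀ x, d (h x) + h (d x) = x - proj x
  d_proj : ∀ x, d (proj x) = 0
  proj_d : ∀ x, proj (d x) = 0
  proj_proj : ∀ x, proj (proj x) = proj x

namespace HomotopyRetract

open TensorAlgebra

variable {K A : Type*} [Field K] [AddCommGroup A] [Module K A] (R : HomotopyRetract K A)

/-- The part of the bar differential induced by the differential. -/
noncomputable def bar₁ : TensorAlgebra K A →ₗ[K] TensorAlgebra K A :=
  consRec (LinearMap.mk₂ K (fun a p => ι K (R.d a) * p.1 - ι K (R.sgn a) * p.2)
    (by intros; simp [add_mul]; abel) (by intros; simp [smul_sub])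
    (by intros; simp [mul_add]; abel) (by intros; simp [smul_sub])) 0

/-- Multiplication of a letter into the first letter of a word. -/
noncomputable def absorb : TensorAlgebra K A →ₗ[K] A →ₗ[K] TensorAlgebra K A :=
  consRec (LinearMap.mk₂ K
    (fun b p => LinearMap.mulRight K p.1 ∘ₗ ι K ∘ₗ R.mul.flip b ∘ₗ (-R.sgn))
    (by intros; ext; simp [add_mul, add_comm]) (by intros; ext; simp)
    (by intros; ext; simp [mul_add, add_comm]) (by intros; ext; simp)) 0

/-- The part of the bar differential induced by the product. -/
noncomputable def bar₂ : TensorAlgebra K A →ₗ[K] TensorAlgebra K A :=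
  consRec (LinearMap.mk₂ K (fun a p => R.absorb p.1 a - ι K (R.sgn a) * p.2)
    (by intros; simp [add_mul]; abel) (by intros; simp [smul_sub])
    (by intros; simp [mul_add]; abel) (by intros; simp [smul_sub])) 0

/-- The homotopy on the tensor algebra induced by `h`. -/
noncomputable def barH : TensorAlgebra K A →ₗ[K] TensorAlgebra K A :=
  consRec (LinearMap.mk₂ K (fun a p => ι K (R.h a) * p.1 - ι K (R.sgn (R.proj a)) * p.2)
    (by intros; simp [add_mul]; abel) (by intros; simp [smul_sub])
    (by intros; simp [mul_add]; abel) (by intros; simp [smul_sub])) 0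

/-- The projection applied to every letter of a word. -/
noncomputable def barProj : TensorAlgebra K A →ₐ[K] TensorAlgebra K A :=
  lift K (ι K ∘ₗ R.proj)

@[simp] theorem bar₁_one : R.bar₁ 1 = 0 := by simp [bar₁]

@[simp] theorem bar₁_cons (a : A) (w : TensorAlgebra K A) :
    R.bar₁ (ι K a * w) = ι K (R.d a) * w - ι K (R.sgn a) * R.bar₁ w := by
  simp [bar₁]

@[simp] theorem absorb_one (a : A) : R.absorb 1 a = 0 := by simp [absorb]

@[simp] theorem absorb_cons (a b : A) (w : TensorAlgebra K A) :
    R.absorb (ι K b * w) a = -(ι K (R.mul (R.sgn a) b) * w) := by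
  simp [absorb]

@[simp] theorem bar₂_one : R.bar₂ 1 = 0 := by simp [bar₂]

@[simp] theorem bar₂_cons (a : A) (w : TensorAlgebra K A) :
    R.bar₂ (ι K a * w) = R.absorb w a - ι K (R.sgn a) * R.bar₂ w := by
  simp [bar₂]

@[simp] theorem barH_one : R.barH 1 = 0 := by simp [barH]

@[simp] theorem barH_cons (a : A) (w : TensorAlgebra K A) :
    R.barH (ι K a * w) = ι K (R.h a) * w - ι K (R.sgn (R.proj a)) * R.barH w := by
  simp [barH]

@[simp] theorem barProj_ι (a : A) : R.barProj (ι K a) = ι K (R.proj a) := by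
  simp [barProj]

theorem bar₁_ι (a : A) : R.bar₁ (ι K a) = ι K (R.d a) := by
  simpa using R.bar₁_cons a 1

theorem bar₂_ι (a : A) : R.bar₂ (ι K a) = 0 := by
  simpa using R.bar₂_cons a 1

theorem bar₁_absorb (a : A) (w : TensorAlgebra K A) :
    R.bar₁ (R.absorb w a) = R.absorb (R.bar₁ w) (R.sgn a) - R.absorb w (R.d a) := by
  have h : R.bar₁ ∘ₗ R.absorb.flip a =
      R.absorb.flip (R.sgn a) ∘ₗ R.bar₁ - R.absorb.flip (R.d a) := by
    refine linearMap_ext_cons (by simp) fun b w _ => ?_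
    simp only [LinearMap.comp_apply, LinearMap.flip_apply, LinearMap.sub_apply, absorb_cons,
      bar₁_cons, map_neg, map_sub, R.d_mul, R.sgn_mul, R.sgn_sgn, R.sgn_d, map_add, add_mul,
      LinearMap.neg_apply, neg_mul]
    abel
  exact LinearMap.congr_fun h w

theorem bar₂_absorb (a : A) (w : TensorAlgebra K A) :
    R.bar₂ (R.absorb w a) = R.absorb (R.bar₂ w) (R.sgn a) := by
  have h : R.bar₂ ∘ₗ R.absorb.flip a = R.absorb.flip (R.sgn a) ∘ₗ R.bar₂ := by
    refine linearMap_ext_cons (by simp) fun b w _ => ?_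
    have h2 : R.absorb.flip (R.mul (R.sgn a) b) =
        -(R.absorb.flip (R.sgn a) ∘ₗ R.absorb.flip b) := by
      refine linearMap_ext_cons (by simp) fun c v _ => ?_
      simp [R.sgn_mul, R.sgn_sgn, R.mul_assoc]
    have h3 := LinearMap.congr_fun h2 w
    simp only [LinearMap.flip_apply, LinearMap.neg_apply, LinearMap.comp_apply] at h3
    simp [R.sgn_mul, R.sgn_sgn, h3, add_comm]
  exact LinearMap.congr_fun h w

theorem bar₂_bar₂ (w : TensorAlgebra K A) : R.bar₂ (R.bar₂ w) = 0 := by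
  have h : R.bar₂ ∘ₗ R.bar₂ = 0 := by
    refine linearMap_ext_cons (by simp) fun a w hw => ?_
    simp only [LinearMap.comp_apply, LinearMap.zero_apply] at hw
    simp [hw, bar₂_absorb]
  exact LinearMap.congr_fun h w

theorem bar₂_bar₁ (w : TensorAlgebra K A) : R.bar₂ (R.bar₁ w) = -R.bar₁ (R.bar₂ w) := by
  have h : R.bar₂ ∘ₗ R.bar₁ = -(R.bar₁ ∘ₗ R.bar₂) := by
    refine linearMap_ext_cons (by simp) fun a w hw => ?_
    simp only [LinearMap.comp_apply, LinearMap.neg_apply] at hw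
    simp [hw, bar₁_absorb, R.sgn_d, R.sgn_sgn]
    abel
  exact LinearMap.congr_fun h w

theorem barH_bar₁ (w : TensorAlgebra K A) :
    R.barH (R.bar₁ w) = w - R.barProj w - R.bar₁ (R.barH w) := by
  have h : R.barH ∘ₗ R.bar₁ = LinearMap.id - R.barProj.toLinearMap - R.bar₁ ∘ₗ R.barH := by
    refine linearMap_ext_cons (by simp) fun a w hw => ?_
    simp only [LinearMap.comp_apply, LinearMap.sub_apply, LinearMap.id_apply,
      AlgHom.toLinearMap_apply] at hw
    have hd : R.d (R.sgn (R.proj a)) = 0 := by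
      rw [R.sgn_proj, R.d_proj]
    have hh : R.h (R.d a) = a - R.proj a - R.d (R.h a) := by
      rw [← R.homotopy]; abel
    simp [hw, R.proj_d, R.sgn_h, ← R.sgn_proj, R.sgn_sgn, hd, hh, sub_mul, mul_sub]
    abel
  exact LinearMap.congr_fun h w

/-- The span of the words of length `n`. -/
abbrev words (K A : Type*) [Field K] [AddCommGroup A] [Module K A] (n : ℕ) :
    Submodule K (TensorAlgebra K A) :=
  LinearMap.range (ι K (M := A)) ^ n

theorem cons_mem_words {n : ℕ} (a : A) {w : TensorAlgebra K A} (hw : w ∈ words K A n) :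
    ι K a * w ∈ words K A (n + 1) := by
  rw [words, pow_succ']
  exact Submodule.mul_mem_mul ⟨a, rfl⟩ hw

theorem words_induction {C : ℕ → TensorAlgebra K A → Prop}
    (one : C 0 1)
    (add : ∀ n x y, C n x → C n y → C n (x + y))
    (smul : ∀ n (r : K) x, C n x → C n (r • x))
    (cons : ∀ n a w, w ∈ words K A n → C n w → C (n + 1) (ι K a * w))
    {n : ℕ} {w : TensorAlgebra K A} (hw : w ∈ words K A n) : C n w := by
  refine Submodule.pow_induction_on_left' _ (C := fun n w _ => C n w) ?_ ?_ ?_ hw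
  · intro r
    simpa [Algebra.algebraMap_eq_smul_one] using smul 0 r 1 one
  · intro x y i _ _ hx hy
    exact add i x y hx hy
  · rintro _ ⟨a, rfl⟩ i x hx hC
    exact cons i a x hx hC

theorem absorb_mem {n : ℕ} (a : A) {w : TensorAlgebra K A} (hw : w ∈ words K A n) :
    R.absorb w a ∈ words K A n := by
  refine words_induction (C := fun n w => R.absorb w a ∈ words K A n) ?_ ?_ ?_ ?_ hw
  · simp
  · intro n x y hx hy
    simpa using add_mem hx hy
  · intro n r x hx
    simpa using Submodule.smul_mem _ r hx
  · intro n b w hw _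
    simpa using cons_mem_words _ hw

theorem bar₂_mem {n : ℕ} {w : TensorAlgebra K A} (hw : w ∈ words K A (n + 1)) :
    R.bar₂ w ∈ words K A n := by
  have key : R.bar₂ w ∈ words K A (n + 1 - 1) := by
    refine words_induction (C := fun n w => R.bar₂ w ∈ words K A (n - 1)) ?_ ?_ ?_ ?_ hw
    · simp
    · intro n x y hx hy
      simpa using add_mem hx hy
    · intro n r x hx
      simpa using Submodule.smul_mem _ r hx
    · intro n b w hw hb
      rw [bar₂_cons]
      refine sub_mem (R.absorb_mem b hw) ?_
      cases n with
      | zero =>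
        obtain ⟨r, rfl⟩ : ∃ r, algebraMap K _ r = w := by simpa [Submodule.mem_one] using hw
        simp [Algebra.algebraMap_eq_smul_one]
      | succ n => exact cons_mem_words _ hb
  exact key

theorem barH_mem {n : ℕ} {w : TensorAlgebra K A} (hw : w ∈ words K A n) :
    R.barH w ∈ words K A n := by
  refine words_induction (C := fun n w => R.barH w ∈ words K A n) ?_ ?_ ?_ ?_ hw
  · simp
  · intro n x y hx hy
    simpa using add_mem hx hy
  · intro n r x hx
    simpa using Submodule.smul_mem _ r hx
  · intro n b w hw hb
    rw [barH_cons]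
    exact sub_mem (cons_mem_words _ hw) (cons_mem_words _ hb)

/-- The projection of a word of length one to cohomology. -/
noncomputable def letterProj : TensorAlgebra K A →ₗ[K] A :=
  consRec (LinearMap.mk₂ K (fun a p => algebraMapInv p.1 • R.proj a)
    (by intros; simp) (by intros; rw [map_smul, smul_comm])
    (by intros; simp [add_smul]) (by intros; simp [mul_smul])) 0

theorem letterProj_ι (a : A) : R.letterProj (ι K a) = R.proj a := by
  rw [← mul_one (ι K a), letterProj, consRec_cons]
  simp

/-- The components of the morphism from the bar construction to cohomology obtained from `proj` by
homological perturbation. -/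
noncomputable def toCoh : ℕ → TensorAlgebra K A →ₗ[K] A
  | 0 => 0
  | 1 => R.letterProj
  | n + 2 => -(toCoh (n + 1) ∘ₗ R.bar₂ ∘ₗ R.barH)

/-- The `n`-th component of the equation saying that `toCoh` vanishes on boundaries of the bar
construction. -/
def IsClosedAt (n : ℕ) : Prop :=
  ∀ w ∈ words K A n, R.toCoh n (R.bar₁ w) = -R.toCoh (n - 1) (R.bar₂ w)

theorem isClosedAt_one : R.IsClosedAt 1 := by
  intro w hw
  obtain ⟨a, rfl⟩ : ∃ a, ι K a = w := by simpa using hw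
  simp [toCoh, bar₁_ι, letterProj_ι, R.proj_d]

theorem toCoh_bar₂_bar₁ {n : ℕ} (hn : R.IsClosedAt (n + 1)) {w : TensorAlgebra K A}
    (hw : w ∈ words K A (n + 2)) : R.toCoh (n + 1) (R.bar₂ (R.bar₁ w)) = 0 := by
  rw [bar₂_bar₁, map_neg, hn _ (R.bar₂_mem hw), bar₂_bar₂]
  simp

theorem isClosedAt_succ {n : ℕ} (hn : R.IsClosedAt (n + 1))
    (h : ∀ w ∈ words K A (n + 2), R.toCoh (n + 1) (R.bar₂ (R.barProj w)) = 0) :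
    R.IsClosedAt (n + 2) := by
  intro w hw
  have h1 := R.toCoh_bar₂_bar₁ hn (R.barH_mem hw)
  simp [toCoh, barH_bar₁, h1, h w hw]

theorem toCoh_bar₂_barProj {n : ℕ} (hn : R.IsClosedAt (n + 1)) {w : TensorAlgebra K A}
    (hw : w ∈ words K A (n + 2)) (hw0 : R.bar₁ w = 0) :
    R.toCoh (n + 1) (R.bar₂ (R.barProj w)) = R.toCoh (n + 1) (R.bar₂ w) := by
  have h1 := R.toCoh_bar₂_bar₁ hn (R.barH_mem hw)
  have h2 := R.barH_bar₁ w
  rw [hw0, map_zero] at h2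
  have h3 : R.barProj w = w - R.bar₁ (R.barH w) := by
    rw [eq_comm, ← sub_eq_zero, h2]; abel
  rw [h3, map_sub, map_sub, h1, sub_zero]

end HomotopyRetract

namespace HomotopyRetract

open TensorAlgebra Finset

variable {K A : Type*} [Field K] [AddCommGroup A] [Module K A] (R : HomotopyRetract K A)

/-- The word of length `n` with letters `u 0, …, u (n - 1)`. -/
noncomputable def word (K : Type*) {A : Type*} [Field K] [AddCommGroup A] [Module K A] (n : ℕ)
    (u : ℕ → A) : TensorAlgebra K A :=
  (List.ofFn fun j : Fin n => ι K (u j)).prod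

theorem word_succ (n : ℕ) (u : ℕ → A) :
    word K (n + 1) u = ι K (u 0) * word K n (fun j => u (j + 1)) := by
  simp [word, List.ofFn_succ]

theorem barProj_word (n : ℕ) (u : ℕ → A) :
    R.barProj (word K n u) = word K n fun j => R.proj (u j) := by
  induction n generalizing u with
  | zero => simp [word]
  | succ n ih => simp [word_succ, ih]

/-- The sum of the words read off the paths with `k` steps from `i` to `n`. -/
noncomputable def paths (K : Type*) {A : Type*} [Field K] [AddCommGroup A] [Module K A]
    (a : ℕ → ℕ → A) (n : ℕ) : ℕ → ℕ → TensorAlgebra K A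
  | 0, i => if i = n then 1 else 0
  | k + 1, i => ∑ j ∈ Ioc i n, ι K (a i j) * paths K a n k j

/-- The Massey-type product read off the rows and columns between `i` and `j`. -/
def masseySum (a : ℕ → ℕ → A) (i j : ℕ) : A :=
  ∑ k ∈ Ioo i j, R.mul (R.sgn (a i k)) (a k j)

variable {a : ℕ → ℕ → A} {n : ℕ}

theorem paths_mem (k i : ℕ) : paths K a n k i ∈ words K A k := by
  induction k generalizing i with
  | zero =>
    rw [paths]
    split_ifs <;> simp
  | succ k ih => exact sum_mem fun j _ => cons_mem_words _ (ih j)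

theorem paths_eq_zero {k i : ℕ} (hi : i ≤ n) (h : n < i + k) : paths K a n k i = 0 := by
  induction k generalizing i with
  | zero => omega
  | succ k ih =>
    refine sum_eq_zero fun j hj => ?_
    rw [mem_Ioc] at hj
    rw [ih hj.2 (by omega), mul_zero]

theorem paths_top {k i : ℕ} (h : i + k = n) :
    paths K a n k i = word K k fun j => a (i + j) (i + j + 1) := by
  induction k generalizing i with
  | zero => simpa [paths, word] using h
  | succ k ih =>
    rw [paths, sum_eq_single_of_mem (i + 1) (by simp; omega), ih (by omega), word_succ]
    · simp [add_assoc, add_comm 1]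
    · intro j hj hj'
      rw [mem_Ioc] at hj
      rw [paths_eq_zero hj.2 (by omega), mul_zero]

theorem bar₁_paths_zero (i : ℕ) : R.bar₁ (paths K a n 0 i) = 0 := by
  rw [paths]
  split_ifs <;> simp

theorem bar₂_paths_one (i : ℕ) : R.bar₂ (paths K a n 1 i) = 0 := by
  rw [paths, map_sum]
  refine sum_eq_zero fun j _ => ?_
  rw [paths]
  split_ifs <;> simp [bar₂_ι]

theorem absorb_paths (k j : ℕ) (b : A) :
    R.absorb (paths K a n (k + 1) j) b =
      -∑ l ∈ Ioc j n, ι K (R.mul (R.sgn b) (a j l)) * paths K a n k l := by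
  simp [paths]

theorem bar_paths_succ (k i : ℕ) :
    R.bar₁ (paths K a n (k + 1) i) + R.bar₂ (paths K a n (k + 2) i) =
      ∑ l ∈ Ioc i n, ι K (R.d (a i l) - R.masseySum a i l) * paths K a n k l -
      ∑ j ∈ Ioc i n, ι K (R.sgn (a i j)) *
        (R.bar₁ (paths K a n k j) + R.bar₂ (paths K a n (k + 1) j)) := by
  have h : ∑ l ∈ Ioc i n, ι K (R.masseySum a i l) * paths K a n k l =
      ∑ j ∈ Ioc i n, ∑ l ∈ Ioc j n,
        ι K (R.mul (R.sgn (a i j)) (a j l)) * paths K a n k l := by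
    simp only [masseySum, map_sum, sum_mul]
    refine sum_comm' fun x y => ?_
    simp only [mem_Ioc, mem_Ioo]
    omega
  rw [paths, paths, map_sum, map_sum]
  simp only [bar₁_cons, bar₂_cons, absorb_paths, map_sub, sub_mul, sum_sub_distrib, h,
    sum_neg_distrib, mul_add, sum_add_distrib]
  abel

/-- The equations of a defining system, with the corner entry normalised to be zero. -/
structure IsDefining (a : ℕ → ℕ → A) (n : ℕ) : Prop where
  corner : a 0 n = 0
  d_eq : ∀ i j, i < j → j ≤ n → (i, j) ≠ (0, n) → R.d (a i j) = R.masseySum a i j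

variable {R}

theorem IsDefining.bar_paths_pos (ha : R.IsDefining a n) (k : ℕ) {i : ℕ} (hi : 0 < i) :
    R.bar₁ (paths K a n k i) + R.bar₂ (paths K a n (k + 1) i) = 0 := by
  induction k generalizing i with
  | zero => rw [bar₁_paths_zero, bar₂_paths_one, add_zero]
  | succ k ih =>
    rw [bar_paths_succ, sum_eq_zero, sum_eq_zero, sub_zero]
    · intro j hj
      rw [mem_Ioc] at hj
      rw [ih (by omega), mul_zero]
    · intro j hj
      rw [mem_Ioc] at hj
      rw [ha.d_eq i j hj.1 hj.2 (by simp; omega), sub_self, map_zero, zero_mul]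

theorem IsDefining.bar_paths (ha : R.IsDefining a n) (hn : 0 < n) (k : ℕ) :
    R.bar₁ (paths K a n (k + 1) 0) + R.bar₂ (paths K a n (k + 2) 0) =
      -(ι K (R.masseySum a 0 n) * paths K a n k n) := by
  rw [bar_paths_succ, sum_eq_single_of_mem n (by simpa using hn), sum_eq_zero]
  · simp [ha.corner]
  · intro j hj
    rw [mem_Ioc] at hj
    rw [ha.bar_paths_pos k hj.1, mul_zero]
  · intro j hj hj'
    rw [mem_Ioc] at hj
    rw [ha.d_eq 0 j hj.1 hj.2 (by simpa using hj'), sub_self, map_zero, zero_mul]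

theorem IsDefining.proj_masseySum_eq (ha : R.IsDefining a n)
    (hcl : ∀ k, 1 ≤ k → k < n → R.IsClosedAt k) (k : ℕ) (hk : k + 1 < n) :
    R.proj (R.masseySum a 0 n) = -R.toCoh (k + 1) (R.bar₂ (paths K a n (k + 2) 0)) := by
  induction k with
  | zero =>
    have h := ha.bar_paths (by omega) 0
    have h1 := hcl 1 le_rfl hk _ (paths_mem (K := K) (a := a) (n := n) 1 0)
    rw [← eq_sub_iff_add_eq] at h
    have h0 : R.toCoh (1 - 1) = 0 := by simp [toCoh]
    rw [h, h0] at h1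
    have h2 : R.toCoh 1 (ι K (R.masseySum a 0 n)) = R.proj (R.masseySum a 0 n) := by
      simp [toCoh, letterProj_ι]
    simp only [paths, if_true, mul_one, map_sub, map_neg, h2, LinearMap.zero_apply, neg_zero] at h1
    simp only [zero_add]
    rw [← sub_eq_zero, ← neg_eq_zero, ← h1]
    simp only [paths]
    abel
  | succ k ih =>
    have h := ha.bar_paths (by omega) (k + 1)
    rw [paths_eq_zero le_rfl (by omega), mul_zero, neg_zero, add_eq_zero_iff_eq_neg] at h
    have h1 := hcl (k + 2) (by omega) hk _ (paths_mem (K := K) (a := a) (n := n) (k + 2) 0)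
    rw [ih (by omega)]
    simp only [Nat.add_succ_sub_one] at h1
    rw [← h1, h, map_neg]

/-- If `toCoh` is closed below `n`, the class of the Massey sum of a defining system depends only
on the classes of its diagonal. -/
theorem IsDefining.proj_masseySum {m : ℕ} (ha : R.IsDefining a (m + 2))
    (hcl : ∀ k, 1 ≤ k → k < m + 2 → R.IsClosedAt k) :
    R.proj (R.masseySum a 0 (m + 2)) =
      -R.toCoh (m + 1) (R.bar₂ (word K (m + 2) fun i => R.proj (a i (i + 1)))) := by
  have hd : R.bar₁ (paths K a (m + 2) (m + 2) 0) = 0 := by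
    have h := ha.bar_paths (by omega) (m + 1)
    rwa [paths_eq_zero le_rfl (by omega), mul_zero, neg_zero,
      paths_eq_zero (k := m + 1 + 2) (by omega) (by omega), map_zero, add_zero] at h
  rw [ha.proj_masseySum_eq hcl m (by omega),
    ← R.toCoh_bar₂_barProj (hcl (m + 1) (by omega) (by omega)) (paths_mem _ _) hd,
    paths_top (by omega), barProj_word]
  simp

variable (R)

theorem d_sgn (x : A) : R.d (R.sgn x) = -R.sgn (R.d x) := by
  rw [R.sgn_d, neg_neg]

theorem d_masseySum
    (ha : ∀ i j, i < j → j ≤ n → (i, j) ≠ (0, n) → R.d (a i j) = R.masseySum a i j) :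
    R.d (R.masseySum a 0 n) = 0 := by
  have h : ∑ k ∈ Ioo 0 n, R.mul (R.sgn (R.masseySum a 0 k)) (a k n) =
      ∑ k ∈ Ioo 0 n, R.mul (a 0 k) (R.masseySum a k n) := by
    simp only [masseySum, map_sum, LinearMap.sum_apply, R.sgn_mul, R.sgn_sgn, R.mul_assoc]
    refine sum_comm' fun x y => ?_
    simp only [mem_Ioo]
    omega
  rw [masseySum, map_sum]
  simp only [R.d_mul, R.sgn_sgn, d_sgn, map_neg, LinearMap.neg_apply, sum_add_distrib,
    sum_neg_distrib]
  rw [neg_add_eq_zero]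
  convert h using 1
  · refine sum_congr rfl fun k hk => ?_
    rw [mem_Ioo] at hk
    rw [ha 0 k hk.1 hk.2.le (by simp; omega)]
  · refine sum_congr rfl fun k hk => ?_
    rw [mem_Ioo] at hk
    rw [ha k n hk.2 le_rfl (by simp; omega)]

/-- The components, up to sign, of the morphism from the cohomology built by successively
integrating Massey sums. -/
def ofCoh : ℕ → (ℕ → A) → A
  | 0, _ => 0
  | 1, x => x 0
  | n + 2, x => R.h (∑ k : Fin (n + 1), R.mul (R.sgn (ofCoh (k + 1) x))
      (ofCoh (n + 1 - k) fun j => x (k + 1 + j)))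

/-- The matrix of values of `ofCoh` on the intervals of a sequence. -/
def ofCohMatrix (x : ℕ → A) (i j : ℕ) : A :=
  R.ofCoh (j - i) fun k => x (i + k)

theorem ofCoh_eq {n : ℕ} (hn : 2 ≤ n) (x : ℕ → A) :
    R.ofCoh n x = R.h (R.masseySum (R.ofCohMatrix x) 0 n) := by
  obtain ⟨n, rfl⟩ := Nat.exists_eq_add_of_le' hn
  rw [ofCoh, masseySum, Fin.sum_univ_eq_sum_range (fun k => R.mul (R.sgn (R.ofCoh (k + 1) x))
    (R.ofCoh (n + 1 - k) fun j => x (k + 1 + j))) (n + 1), range_eq_Ico]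
  congr 1
  have h : Ioo 0 (n + 2) = Ico (0 + 1) (n + 1 + 1) := by ext; simp; omega
  rw [h, ← sum_Ico_add']
  refine sum_congr rfl fun k _ => ?_
  simp [ofCohMatrix]

end HomotopyRetract

namespace HomotopyRetract

open Finset

variable {K A : Type*} [Field K] [AddCommGroup A] [Module K A] (R : HomotopyRetract K A)

theorem ofCohMatrix_shift (x : ℕ → A) (r i j : ℕ) :
    R.ofCohMatrix (fun k => x (r + k)) i j = R.ofCohMatrix x (r + i) (r + j) := by
  simp [ofCohMatrix, Nat.add_sub_add_left, add_assoc]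

theorem masseySum_shift (a : ℕ → ℕ → A) (r i j : ℕ) :
    R.masseySum (fun p q => a (r + p) (r + q)) i j = R.masseySum a (r + i) (r + j) := by
  have h : Ioo (r + i) (r + j) = (Ioo i j).map (addLeftEmbedding r) := by simp
  rw [masseySum, masseySum, h, sum_map]
  rfl

theorem ofCohMatrix_eq {x : ℕ → A} {i j : ℕ} (h : i + 2 ≤ j) :
    R.ofCohMatrix x i j = R.h (R.masseySum (R.ofCohMatrix x) i j) := by
  rw [ofCohMatrix, ofCoh_eq R (by omega)]
  have h1 : R.ofCohMatrix (fun k => x (i + k)) =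
      fun p q => R.ofCohMatrix x (i + p) (i + q) := by
    ext p q
    exact R.ofCohMatrix_shift x i p q
  rw [h1, masseySum_shift, add_zero, Nat.add_sub_cancel' (by omega)]

theorem ofCohMatrix_succ (x : ℕ → A) (i : ℕ) : R.ofCohMatrix x i (i + 1) = x i := by
  simp [ofCohMatrix, ofCoh]

theorem ofCohMatrix_zero (x : ℕ → A) (n : ℕ) : R.ofCohMatrix x 0 n = R.ofCoh n x := by
  simp [ofCohMatrix]

theorem ofCoh_congr {n : ℕ} {x y : ℕ → A} (h : ∀ j < n, x j = y j) :
    R.ofCoh n x = R.ofCoh n y := by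
  induction n using Nat.strong_induction_on generalizing x y with
  | _ n ih =>
    match n with
    | 0 => simp [ofCoh]
    | 1 => simpa [ofCoh] using h 0 one_pos
    | n + 2 =>
      rw [R.ofCoh_eq (by omega), R.ofCoh_eq (by omega)]
      congr 1
      refine sum_congr rfl fun k hk => ?_
      rw [mem_Ioo] at hk
      rw [ofCohMatrix, ofCohMatrix, ofCohMatrix, ofCohMatrix,
        ih (k - 0) (by omega) (y := fun j => y (0 + j)) fun j hj => h _ (by omega),
        ih (n + 2 - k) (by omega) (y := fun j => y (k + j)) fun j hj => h _ (by omega)]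

theorem exists_linear_ofCoh {n : ℕ} (x : ℕ → A) {i : ℕ} (hi : i < n) :
    ∃ L : A →ₗ[K] A, ∀ y, R.ofCoh n (Function.update x i y) = L y := by
  induction n using Nat.strong_induction_on generalizing x i with
  | _ n ih =>
    match n with
    | 0 => omega
    | 1 =>
      obtain rfl : i = 0 := by omega
      exact ⟨LinearMap.id, fun y => by simp [ofCoh]⟩
    | n + 2 =>
      have h : ∀ k, ∃ L : A →ₗ[K] A, k ∈ Ioo 0 (n + 2) → ∀ y,
          R.mul (R.sgn (R.ofCohMatrix (Function.update x i y) 0 k))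
            (R.ofCohMatrix (Function.update x i y) k (n + 2)) = L y := by
        intro k
        by_cases hk : k ∈ Ioo 0 (n + 2)
        swap
        · exact ⟨0, fun h => absurd h hk⟩
        rw [mem_Ioo] at hk
        rcases lt_or_ge i k with hik | hik
        · obtain ⟨L, hL⟩ := ih k hk.2 x hik
          refine ⟨R.mul.flip (R.ofCohMatrix x k (n + 2)) ∘ₗ R.sgn ∘ₗ L, fun _ y => ?_⟩
          rw [ofCohMatrix_zero, hL, ofCohMatrix,
            R.ofCoh_congr (y := fun j => x (k + j)) fun j _ => ?_]
          · rfl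
          · rw [Function.update_of_ne (by omega)]
        · obtain ⟨L, hL⟩ := ih (n + 2 - k) (by omega) (fun j => x (k + j)) (i := i - k) (by omega)
          refine ⟨R.mul (R.sgn (R.ofCoh k x)) ∘ₗ L, fun _ y => ?_⟩
          have h1 : (fun j => Function.update x i y (k + j)) =
              Function.update (fun j => x (k + j)) (i - k) y := by
            ext j
            simp only [Function.update_apply]
            congr 1
            simp only [eq_iff_iff]
            omega
          rw [ofCohMatrix_zero, ofCohMatrix, h1, hL, R.ofCoh_congr (y := x) fun j _ => ?_]
          · rfl
          · rw [Function.update_of_ne (by omega)]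
      choose L hL using h
      refine ⟨R.h ∘ₗ ∑ k ∈ Ioo 0 (n + 2), L k, fun y => ?_⟩
      rw [R.ofCoh_eq (by omega), masseySum, sum_congr rfl fun k hk => hL k hk y]
      simp

/-- Extension of a finite sequence by zero. -/
def extendZero {n : ℕ} (v : Fin n → A) (j : ℕ) : A :=
  if h : j < n then v ⟨j, h⟩ else 0

theorem extendZero_update {n : ℕ} [DecidableEq (Fin n)] (v : Fin n → A) (i : Fin n) (y : A) :
    extendZero (Function.update v i y) = Function.update (extendZero v) i y := by
  ext j
  by_cases h : j < n
  · simp [extendZero, h, Function.update_apply, Fin.ext_iff]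
  · have hj : j ≠ i := by omega
    simp [extendZero, h, Function.update_of_ne hj]

/-- `ofCoh` as a multilinear map. -/
def ofCohMultilinear (n : ℕ) : MultilinearMap K (fun _ : Fin n => A) A where
  toFun v := R.ofCoh n (extendZero v)
  map_update_add' v i y z := by
    obtain ⟨L, hL⟩ := R.exists_linear_ofCoh (extendZero v) i.2
    simp [extendZero_update, hL]
  map_update_smul' v i c y := by
    obtain ⟨L, hL⟩ := R.exists_linear_ofCoh (extendZero v) i.2
    simp [extendZero_update, hL]

theorem ofCohMultilinear_apply (n : ℕ) (x : ℕ → A) :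
    R.ofCohMultilinear n (fun j => x j) = R.ofCoh n x :=
  R.ofCoh_congr fun j hj => by simp [extendZero, hj]

end HomotopyRetract

namespace GVS

variable {K : Type} [Field K] (V : GVS K) {X : Type*} [AddCommGroup X] [Module K X]

/-- The linear map given in each degree by a member of a family of linear maps. -/
noncomputable def glue (f : ℤ → V.carrier →ₗ[K] X) : V.carrier →ₗ[K] X :=
  letI := V.decomp
  DirectSum.toModule K ℤ X (fun n => f n ∘ₗ (V.grading n).subtype) ∘ₗ
    (DirectSum.decomposeLinearEquiv V.grading).toLinearMap

theorem glue_of_mem (f : ℤ → V.carrier →ₗ[K] X) {n : ℤ} {x : V.carrier} (hx : x ∈ V.grading n) :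
    V.glue f x = f n x := by
  let _ := V.decomp
  have h : DirectSum.decomposeLinearEquiv V.grading x = DirectSum.lof K ℤ _ n ⟨x, hx⟩ :=
    DirectSum.decompose_of_mem _ hx
  simp [glue, h]

variable {V} in
theorem linearMap_ext {f g : V.carrier →ₗ[K] X}
    (h : ∀ n, ∀ x ∈ V.grading n, f x = g x) : f = g := by
  let _ := V.decomp
  ext x
  induction x using DirectSum.Decomposition.inductionOn V.grading with
  | zero => simp
  | homogeneous x => exact h _ _ x.2
  | add x y hx hy => rw [map_add, map_add, hx, hy]

/-- The homogeneous component of degree `n`. -/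
noncomputable def component (n : ℤ) : V.carrier →ₗ[K] V.carrier :=
  letI := V.decomp
  (V.grading n).subtype ∘ₗ DirectSum.component K ℤ _ n ∘ₗ
    (DirectSum.decomposeLinearEquiv V.grading).toLinearMap

theorem component_mem (n : ℤ) (x : V.carrier) : V.component n x ∈ V.grading n :=
  Subtype.property _

theorem component_of_mem {n : ℤ} {x : V.carrier} (hx : x ∈ V.grading n) :
    V.component n x = x := by
  let _ := V.decomp
  exact DirectSum.decompose_of_mem_same _ hx

theorem component_of_mem_ne {m n : ℤ} {x : V.carrier} (hx : x ∈ V.grading m) (h : m ≠ n) :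
    V.component n x = 0 := by
  let _ := V.decomp
  exact DirectSum.decompose_of_mem_ne _ hx h

theorem component_of_degree (f : V.carrier →ₗ[K] V.carrier) (p : ℤ)
    (hf : ∀ n, ∀ x ∈ V.grading n, f x ∈ V.grading (n + p)) (n : ℤ) (x : V.carrier) :
    V.component (n + p) (f x) = f (V.component n x) := by
  have h : V.component (n + p) ∘ₗ f = f ∘ₗ V.component n := by
    refine linearMap_ext fun m x hx => ?_
    by_cases hmn : m = n
    · subst hmn
      simp [V.component_of_mem hx, V.component_of_mem (hf _ _ hx)]
    · simp [V.component_of_mem_ne hx hmn,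
        V.component_of_mem_ne (hf _ _ hx) fun h => hmn (add_right_cancel h)]
  exact LinearMap.congr_fun h x

/-- The sign involution `x ↦ (-1)^|x| x`. -/
noncomputable def sgn : V.carrier →ₗ[K] V.carrier :=
  V.glue fun n => ((-1 : K) ^ n) • LinearMap.id

theorem sgn_of_mem {n : ℤ} {x : V.carrier} (hx : x ∈ V.grading n) :
    V.sgn x = ((-1 : K) ^ n) • x := by
  rw [sgn, V.glue_of_mem _ hx]
  rfl

theorem sgn_sgn (x : V.carrier) : V.sgn (V.sgn x) = x := by
  have h : V.sgn ∘ₗ V.sgn = LinearMap.id := by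
    refine linearMap_ext fun n x hx => ?_
    simp [V.sgn_of_mem hx, smul_smul, ← mul_zpow]
  exact LinearMap.congr_fun h x

theorem sgn_of_degree (f : V.carrier →ₗ[K] V.carrier) (p : ℤ)
    (hf : ∀ n, ∀ x ∈ V.grading n, f x ∈ V.grading (n + p)) (x : V.carrier) :
    V.sgn (f x) = ((-1 : K) ^ p) • f (V.sgn x) := by
  have h : V.sgn ∘ₗ f = ((-1 : K) ^ p) • (f ∘ₗ V.sgn) := by
    refine linearMap_ext fun n x hx => ?_
    simp [V.sgn_of_mem hx, V.sgn_of_mem (hf _ _ hx), smul_smul, zpow_add₀, mul_comm]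
  exact LinearMap.congr_fun h x

end GVS

theorem AInftyStr.op_congr {K : Type} [Field K] {V : GVS K} (m : AInftyStr K V) {p q : ℕ}
    (h : p = q) (v : Fin p → V.carrier) (w : Fin q → V.carrier)
    (hvw : ∀ j : Fin p, v j = w (Fin.cast h j)) : m.op p v = m.op q w := by
  subst h
  exact congrArg _ (funext hvw)

namespace DGAlg

variable {K : Type} [Field K] (A : DGAlg K)

/-- The differential as a linear map. -/
def dLin : A.V.carrier →ₗ[K] A.V.carrier where
  toFun := A.d
  map_add' x y := by
    have h (z : A.V.carrier) : A.d z = A.str.op 1 (Function.update (fun _ => 0) 0 z) := by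
      simp only [d, AInftyStr.d]
      congr 1
      ext j
      simp [Subsingleton.elim j 0]
    simp only [h]
    exact (A.str.op 1).map_update_add _ _ _ _
  map_smul' c x := by
    have h (z : A.V.carrier) : A.d z = A.str.op 1 (Function.update (fun _ => 0) 0 z) := by
      simp only [d, AInftyStr.d]
      congr 1
      ext j
      simp [Subsingleton.elim j 0]
    simp only [h]
    exact (A.str.op 1).map_update_smul _ _ _ _

/-- The product as a bilinear map. -/
def mulLin : A.V.carrier →ₗ[K] A.V.carrier →ₗ[K] A.V.carrier :=
  have h1 (x y : A.V.carrier) : ![x, y] = Function.update ![0, y] 0 x := by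
    ext j; fin_cases j <;> rfl
  have h2 (x y : A.V.carrier) : ![x, y] = Function.update ![x, 0] 1 y := by
    ext j; fin_cases j <;> rfl
  LinearMap.mk₂ K A.mul
    (fun x y z => by
      rw [mul, mul, mul, h1 _ z, h1 x z, h1 y z]; exact (A.str.op 2).map_update_add _ _ _ _)
    (fun c x y => by
      rw [mul, mul, h1 _ y, h1 x y]; exact (A.str.op 2).map_update_smul _ _ _ _)
    (fun x y z => by
      rw [mul, mul, mul, h2 x, h2 x y, h2 x z]; exact (A.str.op 2).map_update_add _ _ _ _)
    (fun c x y => by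
      rw [mul, mul, h2 x, h2 x y]; exact (A.str.op 2).map_update_smul _ _ _ _)

@[simp] theorem dLin_apply (x : A.V.carrier) : A.dLin x = A.d x := rfl

@[simp] theorem mulLin_apply (x y : A.V.carrier) : A.mulLin x y = A.mul x y := rfl

variable {A}

theorem d_mem {n : ℤ} {x : A.V.carrier} (hx : x ∈ A.V.grading n) :
    A.d x ∈ A.V.grading (n + 1) := by
  have h := A.str.op_degree 1 (fun _ => n) (fun _ => x) fun _ => hx
  simpa [d, AInftyStr.d] using h

theorem mul_mem {m n : ℤ} {x y : A.V.carrier} (hx : x ∈ A.V.grading m) (hy : y ∈ A.V.grading n) :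
    A.mul x y ∈ A.V.grading (m + n) := by
  have h := A.str.op_degree 2 ![m, n] ![x, y] fun i => by fin_cases i <;> assumption
  simpa [mul] using h

theorem d_d_of_mem {n : ℤ} {x : A.V.carrier} (hx : x ∈ A.V.grading n) : A.d (A.d x) = 0 := by
  have h := A.stasheff 1 le_rfl (fun _ => n) (fun _ => x) fun _ => hx
  simp at h
  refine Eq.trans (A.str.op_congr rfl _ _ fun j => ?_) h
  rw [Subsingleton.elim j 0]
  rfl

theorem d_mul_of_mem {m n : ℤ} {x y : A.V.carrier} (hx : x ∈ A.V.grading m)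
    (hy : y ∈ A.V.grading n) :
    A.d (A.mul x y) = A.mul (A.d x) y + ((-1 : K) ^ m) • A.mul x (A.d y) := by
  have h := A.stasheff 2 (by norm_num) (fun i => if i = 0 then m else n)
    (fun i => if i = 0 then x else y) fun i => by split_ifs <;> assumption
  have e1 : Finset.Icc 1 2 = {1, 2} := rfl
  simp [Finset.sum_range_succ, e1] at h
  have h' : -A.mul (A.d x) y + A.d (A.mul x y) + ((-1 : K) ^ (1 + m)) • A.mul x (A.d y) = 0 := by
    refine Eq.trans (congrArg₂ _ (congrArg₂ _ (congrArg _ ?_) ?_) (congrArg _ ?_)) h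
    · exact A.str.op_congr rfl _ _ fun j => by fin_cases j <;> rfl
    · refine A.str.op_congr rfl _ _ fun j => ?_
      rw [Subsingleton.elim j 0]
      exact A.str.op_congr rfl _ _ fun j => by fin_cases j <;> rfl
    · exact A.str.op_congr rfl _ _ fun j => by fin_cases j <;> rfl
  rw [zpow_add₀ (by simp), zpow_one, neg_one_mul, neg_smul, ← sub_eq_add_neg, sub_eq_zero,
    neg_add_eq_iff_eq_add] at h'
  exact h'

theorem mul_assoc_of_mem {l m n : ℤ} {x y z : A.V.carrier} (hx : x ∈ A.V.grading l)
    (hy : y ∈ A.V.grading m) (hz : z ∈ A.V.grading n) :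
    A.mul (A.mul x y) z = A.mul x (A.mul y z) := by
  have h := A.stasheff 3 (by norm_num) (fun i => if i = 0 then l else if i = 1 then m else n)
    (fun i => if i = 0 then x else if i = 1 then y else z)
    fun i => by split_ifs <;> assumption
  have e1 : Finset.Icc 1 2 = {1, 2} := rfl
  have e2 : Finset.Icc 1 3 = {1, 2, 3} := rfl
  simp [Finset.sum_range_succ, e1, e2, A.higher 3 le_rfl] at h
  have h' : A.mul (A.mul x y) z + 0 + ((-1 : K) ^ (1 + 2 * l)) • A.mul x (A.mul y z) = 0 := by
    refine Eq.trans (congrArg₂ _ (congrArg₂ _ ?_ ?_) (congrArg _ ?_)) h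
    · refine A.str.op_congr rfl _ _ fun j => ?_
      fin_cases j
      · exact A.str.op_congr rfl _ _ fun j => by fin_cases j <;> rfl
      · rfl
    · exact ((A.str.op 1).map_coord_zero 0 rfl).symm
    · refine A.str.op_congr rfl _ _ fun j => ?_
      fin_cases j
      · rfl
      · exact A.str.op_congr rfl _ _ fun j => by fin_cases j <;> rfl
  rw [zpow_add₀ (by simp), zpow_one, zpow_mul, neg_one_mul, neg_smul, ← sub_eq_add_neg, sub_eq_zero,
    add_zero] at h'
  simpa using h'

end DGAlg

namespace DGAlg

variable {K : Type} [Field K] (A : DGAlg K)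

theorem d_d (x : A.V.carrier) : A.d (A.d x) = 0 := by
  have h : A.dLin ∘ₗ A.dLin = 0 := GVS.linearMap_ext fun n x hx => d_d_of_mem hx
  exact LinearMap.congr_fun h x

theorem d_mul (x y : A.V.carrier) :
    A.d (A.mul x y) = A.mul (A.d x) y + A.mul (A.V.sgn x) (A.d y) := by
  have h : A.mulLin.compr₂ A.dLin =
      A.mulLin ∘ₗ A.dLin + A.mulLin.compl₁₂ A.V.sgn A.dLin := by
    refine GVS.linearMap_ext fun m x hx => GVS.linearMap_ext fun n y hy => ?_
    have h := d_mul_of_mem hx hy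
    simp only [← dLin_apply, ← mulLin_apply] at h
    simp only [LinearMap.compr₂_apply, h, LinearMap.add_apply, LinearMap.comp_apply,
      LinearMap.compl₁₂_apply, A.V.sgn_of_mem hx, map_smul, LinearMap.smul_apply]
  exact LinearMap.congr_fun₂ h x y

theorem mul_assoc (x y z : A.V.carrier) : A.mul (A.mul x y) z = A.mul x (A.mul y z) := by
  have h1 {l m : ℤ} {x y : A.V.carrier} (hx : x ∈ A.V.grading l) (hy : y ∈ A.V.grading m) :
      A.mulLin (A.mul x y) = A.mulLin x ∘ₗ A.mulLin y :=
    GVS.linearMap_ext fun n z hz => mul_assoc_of_mem hx hy hz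
  have h2 {l : ℤ} {x : A.V.carrier} (hx : x ∈ A.V.grading l) :
      A.mulLin.flip z ∘ₗ A.mulLin x = A.mulLin x ∘ₗ A.mulLin.flip z :=
    GVS.linearMap_ext fun m y hy => LinearMap.congr_fun (h1 hx hy) z
  have h3 : A.mulLin.flip z ∘ₗ A.mulLin.flip y = A.mulLin.flip (A.mul y z) :=
    GVS.linearMap_ext fun l x hx => LinearMap.congr_fun (h2 hx) y
  exact LinearMap.congr_fun h3 x

theorem sgn_mul (x y : A.V.carrier) :
    A.V.sgn (A.mul x y) = A.mul (A.V.sgn x) (A.V.sgn y) := by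
  have h : A.mulLin.compr₂ A.V.sgn = A.mulLin.compl₁₂ A.V.sgn A.V.sgn := by
    refine GVS.linearMap_ext fun m x hx => GVS.linearMap_ext fun n y hy => ?_
    simp only [LinearMap.compr₂_apply, mulLin_apply, A.V.sgn_of_mem (mul_mem hx hy),
      LinearMap.compl₁₂_apply, A.V.sgn_of_mem hx, A.V.sgn_of_mem hy, map_smul,
      LinearMap.smul_apply, smul_smul]
    rw [zpow_add₀ (by simp), mul_comm]
  exact LinearMap.congr_fun₂ h x y

/-- There is a map of degree `-1` which is a partial inverse of the differential and squares to
zero between its images. -/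
theorem exists_homotopy : ∃ h : A.V.carrier →ₗ[K] A.V.carrier,
    (∀ n, ∀ x ∈ A.V.grading n, h x ∈ A.V.grading (n + -1)) ∧
    (∀ x, A.d (h (A.d x)) = A.d x) ∧ ∀ x, A.d (h (h (A.d x))) = 0 := by
  obtain ⟨g, hg⟩ := A.dLin.rangeRestrict.exists_rightInverse_of_surjective
    A.dLin.range_rangeRestrict
  obtain ⟨k, hk⟩ := g.exists_extend
  have hdk (x : A.V.carrier) : A.d (k (A.d x)) = A.d x := by
    have h1 : k (A.dLin x) = g (A.dLin.rangeRestrict x) :=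
      LinearMap.congr_fun hk (A.dLin.rangeRestrict x)
    have h2 := congrArg Subtype.val (LinearMap.congr_fun hg (A.dLin.rangeRestrict x))
    rw [← dLin_apply, ← dLin_apply, h1]
    exact h2
  let h₀ : A.V.carrier →ₗ[K] A.V.carrier := A.V.glue fun n => A.V.component (n + -1) ∘ₗ k
  have hdeg (n : ℤ) (x) (hx : x ∈ A.V.grading n) : h₀ x ∈ A.V.grading (n + -1) := by
    simp only [h₀, A.V.glue_of_mem _ hx]
    exact A.V.component_mem _ _
  have hd (x : A.V.carrier) : A.d (h₀ (A.d x)) = A.d x := by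
    have h : A.dLin ∘ₗ h₀ ∘ₗ A.dLin = A.dLin := by
      refine GVS.linearMap_ext fun n x hx => ?_
      have hc := A.V.component_of_degree A.dLin 1 (fun n x hx => d_mem hx) n (k (A.d x))
      simp only [LinearMap.comp_apply, h₀, dLin_apply, A.V.glue_of_mem _ (d_mem hx),
        add_neg_cancel_right] at hc ⊢
      rw [← hc, hdk, A.V.component_of_mem (d_mem hx)]
    exact LinearMap.congr_fun h x
  refine ⟨h₀ ∘ₗ (LinearMap.id - h₀ ∘ₗ A.dLin), fun n x hx => hdeg n _ (sub_mem hx ?_), fun x => ?_,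
    fun x => ?_⟩
  · simpa using hdeg _ _ (d_mem hx)
  · simp [d_d, hd]
  · have hd' (x : A.V.carrier) : A.dLin (h₀ (A.dLin x)) = A.dLin x := hd x
    have dd (x : A.V.carrier) : A.dLin (A.dLin x) = 0 := A.d_d x
    simp only [← dLin_apply]
    simp [dd, hd', -dLin_apply]

/-- A homotopy retraction of a dg-algebra onto representatives of its cohomology. -/
structure GradedRetract extends HomotopyRetract K A.V.carrier where
  d_eq : ∀ x, d x = A.d x
  sgn_eq : ∀ x, sgn x = A.V.sgn x
  mul_eq : ∀ x y, mul x y = A.mul x y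
  h_mem : ∀ n, ∀ x ∈ A.V.grading n, h x ∈ A.V.grading (n + -1)

theorem nonempty_gradedRetract : Nonempty A.GradedRetract := by
  obtain ⟨h, hdeg, hd, hh⟩ := A.exists_homotopy
  have sgn_d (x : A.V.carrier) : A.V.sgn (A.dLin x) = -A.dLin (A.V.sgn x) := by
    simpa using A.V.sgn_of_degree A.dLin 1 (fun n x hx => d_mem hx) x
  have sgn_h (x : A.V.carrier) : A.V.sgn (h x) = -h (A.V.sgn x) := by
    simpa using A.V.sgn_of_degree h (-1) hdeg x
  have hd' (x : A.V.carrier) : A.dLin (h (A.dLin x)) = A.dLin x := hd x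
  have hh' (x : A.V.carrier) : A.dLin (h (h (A.dLin x))) = 0 := hh x
  have dd (x : A.V.carrier) : A.dLin (A.dLin x) = 0 := A.d_d x
  exact ⟨{
    d := A.dLin
    sgn := A.V.sgn
    mul := A.mulLin
    proj := LinearMap.id - A.dLin ∘ₗ h - h ∘ₗ A.dLin
    h := h
    sgn_sgn := A.V.sgn_sgn
    sgn_d := sgn_d
    sgn_mul := A.sgn_mul
    sgn_h := sgn_h
    sgn_proj := fun x => by simp [sgn_d, sgn_h, -dLin_apply]
    d_mul := A.d_mul
    mul_assoc := A.mul_assoc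
    homotopy := fun x => by simp; abel
    d_proj := fun x => by simp [hd', dd, -dLin_apply]
    proj_d := fun x => by simp [hd', dd, -dLin_apply]
    proj_proj := fun x => by simp [hd', dd, hh', -dLin_apply]
    d_eq := fun _ => rfl
    sgn_eq := fun _ => rfl
    mul_eq := fun _ _ => rfl
    h_mem := hdeg }⟩

end DGAlg

open HomotopyRetract in
theorem GVS.words_le {K : Type} [Field K] (V : GVS K) {n : ℕ}
    {S : Submodule K (TensorAlgebra K V.carrier)}
    (hS : ∀ (e : ℕ → ℤ) (u : ℕ → V.carrier), (∀ i, u i ∈ V.grading (e i)) → word K n u ∈ S) :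
    words K V.carrier n ≤ S := by
  intro w hw
  let H (n : ℕ) : Submodule K (TensorAlgebra K V.carrier) := Submodule.span K
    {w | ∃ (e : ℕ → ℤ) (u : ℕ → V.carrier), (∀ i, u i ∈ V.grading (e i)) ∧ word K n u = w}
  have hHS : H n ≤ S := Submodule.span_le.2 fun w ⟨e, u, hu, hw⟩ => hw ▸ hS e u hu
  refine hHS (words_induction (C := fun n w => w ∈ H n) ?_ ?_ ?_ ?_ hw)
  · exact Submodule.subset_span ⟨fun _ => 0, fun _ => 0, fun i => zero_mem _, by simp [word]⟩
  · exact fun n w w' => add_mem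
  · exact fun n c w => Submodule.smul_mem _ c
  · intro n a w _ hw
    have h1 : (H (n + 1)).mkQ ∘ₗ LinearMap.mulRight K w ∘ₗ TensorAlgebra.ι K = 0 := by
      refine GVS.linearMap_ext fun d a ha => (Submodule.Quotient.mk_eq_zero _).2 ?_
      refine Submodule.span_induction (p := fun w _ => TensorAlgebra.ι K a * w ∈ H (n + 1))
        ?_ (by simp) (fun x y _ _ hx hy => ?_) (fun c x _ hx => ?_) hw
      · rintro _ ⟨e, u, hu, rfl⟩
        refine Submodule.subset_span ⟨fun | 0 => d | i + 1 => e i, fun | 0 => a | i + 1 => u i,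
          fun | 0 => ha | i + 1 => hu i, word_succ _ _⟩
      · rw [mul_add]; exact add_mem hx hy
      · rw [mul_smul_comm]; exact Submodule.smul_mem _ c hx
    exact (Submodule.Quotient.mk_eq_zero _).1 (LinearMap.congr_fun h1 a)

theorem mDeg_succ (e : ℕ → ℤ) (i : ℕ) : mDeg e i (i + 1) = e i := by
  simp [mDeg]

theorem mDeg_add_mDeg (e : ℕ → ℤ) {i k j : ℕ} (hik : i ≤ k) (hkj : k ≤ j) :
    mDeg e i k + mDeg e k j = mDeg e i j + 1 := by
  rw [mDeg, mDeg, mDeg, ← Finset.sum_Ico_consecutive e hik hkj]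
  ring

namespace DGAlg.GradedRetract

open HomotopyRetract Finset

variable {K : Type} [Field K] {A : DGAlg K} (R : A.GradedRetract)

theorem proj_mem {n : ℤ} {x : A.V.carrier} (hx : x ∈ A.V.grading n) :
    R.proj x ∈ A.V.grading n := by
  have h : R.proj x = x - (A.d (R.h x) + R.h (A.d x)) := by
    rw [← R.d_eq, ← R.d_eq, R.homotopy]
    abel
  rw [h]
  refine sub_mem hx (add_mem ?_ ?_)
  · simpa using d_mem (R.h_mem n x hx)
  · simpa using R.h_mem _ _ (d_mem hx)

theorem masseySum_eq (e : ℕ → ℤ) {a : ℕ → ℕ → A.V.carrier} {i j : ℕ}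
    (ha : ∀ k ∈ Ioo i j, a i k ∈ A.V.grading (mDeg e i k)) :
    R.masseySum a i j =
      ∑ k ∈ Ioo i j, A.mul (((-1 : K) ^ mDeg e i k) • a i k) (a k j) := by
  refine sum_congr rfl fun k hk => ?_
  rw [R.mul_eq, R.sgn_eq, A.V.sgn_of_mem (ha k hk)]

theorem masseySum_mem {e : ℕ → ℤ} {a : ℕ → ℕ → A.V.carrier} {i j : ℕ}
    (h₁ : ∀ k ∈ Ioo i j, a i k ∈ A.V.grading (mDeg e i k))
    (h₂ : ∀ k ∈ Ioo i j, a k j ∈ A.V.grading (mDeg e k j)) :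
    R.masseySum a i j ∈ A.V.grading (mDeg e i j + 1) := by
  rw [R.masseySum_eq e h₁]
  refine sum_mem fun k hk => ?_
  have hk' := mem_Ioo.1 hk
  rw [← mDeg_add_mDeg e hk'.1.le hk'.2.le]
  exact mul_mem (Submodule.smul_mem _ _ (h₁ k hk)) (h₂ k hk)

theorem ofCohMatrix_mem {e : ℕ → ℤ} {x : ℕ → A.V.carrier}
    (hx : ∀ i, x i ∈ A.V.grading (e i)) {i j : ℕ} (hij : i < j) :
    R.ofCohMatrix x i j ∈ A.V.grading (mDeg e i j) := by
  induction hm : j - i using Nat.strong_induction_on generalizing i j with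
  | _ m ih =>
    obtain rfl | h := (Nat.succ_le_of_lt hij).eq_or_lt
    · rw [Nat.succ_eq_add_one, ofCohMatrix_succ, mDeg_succ]
      exact hx i
    · rw [ofCohMatrix_eq _ h]
      have h1 := R.masseySum_mem (e := e) (a := R.ofCohMatrix x) (i := i) (j := j)
        (fun k hk => ?_) fun k hk => ?_
      · simpa using R.h_mem _ _ h1
      all_goals
        have hk' := mem_Ioo.1 hk
        exact ih _ (by omega) (by omega) rfl

theorem ofCoh_mem {e : ℕ → ℤ} {x : ℕ → A.V.carrier}
    (hx : ∀ i, x i ∈ A.V.grading (e i)) (n : ℕ) : R.ofCoh n x ∈ A.V.grading (mDeg e 0 n) := by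
  obtain rfl | hn := n.eq_zero_or_pos
  · simp [ofCoh]
  · rw [← ofCohMatrix_zero]
    exact R.ofCohMatrix_mem hx hn

theorem word_congr {n : ℕ} {u v : ℕ → A.V.carrier} (h : ∀ i < n, u i = v i) :
    word K n u = word K n v := by
  simp [word, h]

/-- The class of the value of a defining system is determined by the classes it is built on. -/
theorem proj_value {m : ℕ} (hcl : ∀ k, 1 ≤ k → k < m + 2 → R.IsClosedAt k) {e : ℕ → ℤ}
    {u : ℕ → A.V.carrier} (ds : DefiningSystem A (m + 2) e u) :
    R.proj ds.value =
      -R.toCoh (m + 1) (R.bar₂ (word K (m + 2) fun i => R.proj (u i))) := by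
  let a (i j : ℕ) : A.V.carrier := if (i, j) = (0, m + 2) then 0 else ds.a i j
  have ha {i j : ℕ} (h : (i, j) ≠ (0, m + 2)) : a i j = ds.a i j := if_neg h
  have hsum {i j : ℕ} (hj : j ≤ m + 2) : R.masseySum a i j =
      ∑ k ∈ Ioo i j, A.mul (((-1 : K) ^ mDeg e i k) • ds.a i k) (ds.a k j) := by
    have h1 : R.masseySum a i j = R.masseySum ds.a i j := by
      refine sum_congr rfl fun k hk => ?_
      have hk' := mem_Ioo.1 hk
      rw [ha (by simp; omega), ha (by simp; omega)]
    rw [h1, R.masseySum_eq e]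
    intro k hk
    have hk' := mem_Ioo.1 hk
    exact ds.mem_grading i k hk'.1 (by omega) (by simp; omega)
  have hdef : R.IsDefining a (m + 2) :=
    ⟨if_pos rfl, fun i j hij hj h => by rw [ha h, R.d_eq, ds.d_eq i j hij hj h, hsum hj]⟩
  rw [DefiningSystem.value, ← hsum le_rfl, hdef.proj_masseySum hcl]
  congr 3
  refine word_congr fun i hi => ?_
  rw [ha (by simp; omega)]
  obtain ⟨c, hc⟩ := ds.represents i hi
  rw [sub_eq_iff_eq_add.1 hc, map_add, ← R.d_eq, R.proj_d, zero_add]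

/-- On fixed points of the projection, the matrix of higher maps is a defining system as soon as
it satisfies the Massey equations off the corner. -/
def definingSystem {n : ℕ} {e : ℕ → ℤ} {x : ℕ → A.V.carrier}
    (hx : ∀ i, x i ∈ A.V.grading (e i))
    (hd : ∀ i j, i < j → j ≤ n → (i, j) ≠ (0, n) →
      R.d (R.ofCohMatrix x i j) = R.masseySum (R.ofCohMatrix x) i j) :
    DefiningSystem A n e x where
  a := R.ofCohMatrix x
  mem_grading i j hij _ _ := R.ofCohMatrix_mem hx hij
  represents i _ := ⟨0, by rw [ofCohMatrix_succ, sub_self, ← dLin_apply, map_zero]⟩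
  d_eq i j hij hj h := by
    rw [← R.d_eq, hd i j hij hj h, R.masseySum_eq e]
    exact fun k hk => R.ofCohMatrix_mem hx (mem_Ioo.1 hk).1

theorem isClosedAt_and_d_ofCoh
    (hprod : ∀ x y, A.d x = 0 → A.d y = 0 → ∃ c, A.mul x y = A.d c)
    (hmassey : ∀ n, 3 ≤ n → ∀ (dg : ℕ → ℤ) (u : ℕ → A.V.carrier),
      ValidReps A n dg u → MasseyDefined A n dg u → MasseyVanishes A n dg u)
    {n : ℕ} (hn : 1 ≤ n) :
    R.IsClosedAt n ∧ ∀ (e : ℕ → ℤ) (x : ℕ → A.V.carrier), (∀ i, x i ∈ A.V.grading (e i)) →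
      (∀ i, R.proj (x i) = x i) →
      R.d (R.ofCoh n x) = R.masseySum (R.ofCohMatrix x) 0 n := by
  induction n using Nat.strong_induction_on with
  | _ n ih =>
    match n with
    | 0 => omega
    | 1 =>
      refine ⟨R.isClosedAt_one, fun e x _ hp => ?_⟩
      rw [ofCoh, ← hp 0, R.d_proj, masseySum]
      rfl
    | m + 2 =>
      have hd {e : ℕ → ℤ} {x : ℕ → A.V.carrier} (hx : ∀ i, x i ∈ A.V.grading (e i))
          (hp : ∀ i, R.proj (x i) = x i) (i j : ℕ) (hij : i < j) (hj : j ≤ m + 2)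
          (h : (i, j) ≠ (0, m + 2)) :
          R.d (R.ofCohMatrix x i j) = R.masseySum (R.ofCohMatrix x) i j := by
        have hlt : j - i < m + 2 := by
          simp at h
          omega
        have h1 := (ih (j - i) hlt (by omega)).2 _ _ (fun k => hx (i + k)) fun k => hp (i + k)
        have h2 : R.ofCohMatrix (fun k => x (i + k)) =
            fun p q => R.ofCohMatrix x (i + p) (i + q) := by
          ext p q
          exact R.ofCohMatrix_shift x i p q
        rwa [h2, masseySum_shift, add_zero, Nat.add_sub_cancel' hij.le] at h1
      have hcl (k : ℕ) (h1 : 1 ≤ k) (h2 : k < m + 2) : R.IsClosedAt k := (ih k h2 h1).1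
      have key {e : ℕ → ℤ} {x : ℕ → A.V.carrier} (hx : ∀ i, x i ∈ A.V.grading (e i))
          (hp : ∀ i, R.proj (x i) = x i) :
          R.toCoh (m + 1) (R.bar₂ (word K (m + 2) fun i => R.proj (x i))) = 0 := by
        have hdx (i : ℕ) : A.d (x i) = 0 := by rw [← hp i, ← R.d_eq, R.d_proj]
        have hv : MasseyVanishes A (m + 2) e x := by
          obtain rfl | hm := m.eq_zero_or_pos
          · refine ⟨R.definingSystem hx (hd hx hp), ?_⟩
            obtain ⟨c, hc⟩ := hprod (((-1 : K) ^ mDeg e 0 1) • x 0) (x 1)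
              (by rw [← dLin_apply, map_smul, dLin_apply, hdx, smul_zero]) (hdx 1)
            refine ⟨c, ?_⟩
            have h01 : Ioo 0 (0 + 2) = {1} := rfl
            rw [sub_zero, ← hc, DefiningSystem.value, h01, sum_singleton]
            exact congrArg₂ (fun y z => A.mul (((-1 : K) ^ mDeg e 0 1) • y) z)
              (R.ofCohMatrix_succ x 0) (R.ofCohMatrix_succ x 1)
          · exact hmassey (m + 2) (by omega) e x (fun i _ => ⟨hdx i, hx i⟩)
              ⟨R.definingSystem hx (hd hx hp)⟩
        obtain ⟨ds, c, hc⟩ := hv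
        rw [← neg_eq_zero, ← R.proj_value hcl ds, ← sub_zero ds.value, hc, ← R.d_eq, R.proj_d]
      refine ⟨R.isClosedAt_succ (hcl (m + 1) (by omega) (by omega)) fun w hw => ?_,
        fun e x hx hp => ?_⟩
      · let L := R.toCoh (m + 1) ∘ₗ R.bar₂ ∘ₗ R.barProj.toLinearMap
        refine A.V.words_le (S := LinearMap.ker L) (fun e u hu => ?_) hw
        have h1 := key (e := e) (x := fun i => R.proj (u i)) (fun i => R.proj_mem (hu i))
          fun i => R.proj_proj _
        simpa [L, barProj_word, R.proj_proj] using h1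
      · have h1 := R.proj_value hcl (R.definingSystem hx (hd hx hp))
        rw [key hx hp, neg_zero, DefiningSystem.value] at h1
        have h2 := R.masseySum_eq e (a := R.ofCohMatrix x) (i := 0) (j := m + 2)
          fun k hk => R.ofCohMatrix_mem hx (mem_Ioo.1 hk).1
        have h3 := R.homotopy (R.masseySum (R.ofCohMatrix x) 0 (m + 2))
        rw [R.d_masseySum (hd hx hp), map_zero, add_zero, ← ofCoh_eq _ (by omega)] at h3
        rw [h3, sub_eq_self, h2]
        exact h1

end DGAlg.GradedRetract

/-- The composition of `n` into `k` and `n - k`. -/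
def Composition.pair {n k : ℕ} (hk : k ∈ Finset.Ioo 0 n) : Composition n where
  blocks := [k, n - k]
  blocks_pos := by
    have h := Finset.mem_Ioo.1 hk
    intro i hi
    simp at hi
    omega
  blocks_sum := by
    have h := Finset.mem_Ioo.1 hk
    simp
    omega

theorem Composition.sum_eq_single_add_sum_pair {M : Type*} [AddCommMonoid M] {n : ℕ} (hn : 0 < n)
    (T : Composition n → M) (hT : ∀ c, 3 ≤ c.length → T c = 0) :
    ∑ c, T c = T (single n hn) + ∑ k ∈ (Finset.Ioo 0 n).attach, T (pair k.2) := by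
  classical
  let p (k : Finset.Ioo 0 n) : Composition n := pair k.2
  have hp : Function.Injective p := fun k l h => by
    have h1 : [(k : ℕ), n - k] = [(l : ℕ), n - l] := congrArg blocks h
    exact Subtype.ext (List.cons.inj h1).1
  have hs : single n hn ∉ (Finset.Ioo 0 n).attach.image p := fun h => by
    obtain ⟨k, _, hk⟩ := Finset.mem_image.1 h
    simpa [p, pair] using congrArg (List.length ∘ blocks) hk
  rw [← Finset.sum_subset (Finset.subset_univ (insert (single n hn)
    ((Finset.Ioo 0 n).attach.image p))) fun c _ hc => ?_, Finset.sum_insert hs,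
    Finset.sum_image hp.injOn]
  refine hT c (not_lt.1 fun hlt => hc ?_)
  rw [Finset.mem_insert]
  by_cases h1 : c.length = 1
  · exact Or.inl ((eq_single_iff_length hn).2 h1)
  · have h2 : c.blocks.length = 2 := by
      have := c.length_pos_of_pos hn
      change c.length = 2
      omega
    obtain ⟨k, l, hkl⟩ := List.length_eq_two.1 h2
    have hsum := c.blocks_sum
    have hk : 0 < k := c.blocks_pos (by simp [hkl])
    have hl : 0 < l := c.blocks_pos (by simp [hkl])
    simp only [hkl, List.sum_cons, List.sum_nil, add_zero] at hsum
    refine Or.inr (Finset.mem_image.2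
      ⟨⟨k, Finset.mem_Ioo.2 ⟨hk, by omega⟩⟩, Finset.mem_attach _ _, ?_⟩)
    apply Composition.ext
    simp only [p, pair, hkl, ← hsum, Nat.add_sub_cancel_left]

/-- Over a dg-algebra, only the compositions into at most two parts contribute to the equations
of an `A∞`-morphism. -/
theorem AInftyHomData.sum_composition {K : Type} [Field K] {V : GVS K} {A : DGAlg K}
    (φ : AInftyHomData K V A.V) {n : ℕ} (hn : 1 ≤ n) (e : ℕ → ℤ) (a : ℕ → V.carrier) :
    ∑ c : Composition n,
      ((-1 : K) ^ ((∑ j : Fin c.length,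
            ((c.length : ℤ) - 1 - (j : ℤ)) * ((c.blocksFun j : ℤ) - 1))
          + ∑ j : Fin c.length,
            (1 - (c.blocksFun j : ℤ)) * ∑ i ∈ Finset.range (c.sizeUpTo (j : ℕ)), e i)) •
        A.str.op c.length (fun j : Fin c.length =>
          φ.f (c.blocksFun j) (fun i : Fin (c.blocksFun j) =>
            a (c.sizeUpTo (j : ℕ) + (i : ℕ)))) =
    A.d (φ.f n fun i => a i) + ∑ k ∈ Finset.Ioo 0 n,
      ((-1 : K) ^ (((k : ℤ) - 1) + (1 - ((n : ℤ) - k)) * ∑ i ∈ Finset.range k, e i)) •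
        A.mul (φ.f k fun i => a i) (φ.f (n - k) fun i => a (k + i)) := by
  rw [Composition.sum_eq_single_add_sum_pair hn]
  · congr 1
    · refine Eq.trans (congrArg₂ (fun (p : ℤ) y => ((-1 : K) ^ p) • y) (?_ : _ = (0 : ℤ))
        (?_ : _ = A.d (φ.f n fun i => a i))) (by simp)
      · refine (congrArg₂ _ (Fin.sum_univ_one _) (Fin.sum_univ_one _)).trans ?_
        simp [Composition.single_length]
      · refine A.str.op_congr rfl _ _ fun j => ?_
        rw [Subsingleton.elim (α := Fin 1) j 0]
        exact congrArg (φ.f n) (funext fun i => congrArg a (zero_add _))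
    · rw [← Finset.sum_attach (Finset.Ioo 0 n)]
      refine Finset.sum_congr rfl fun k _ => ?_
      have hk := Finset.mem_Ioo.1 k.2
      have hop (w : Fin 2 → A.V.carrier) : A.str.op 2 w = A.mul (w 0) (w 1) :=
        congrArg _ (by ext j; fin_cases j <;> rfl)
      refine congrArg₂ (fun (p : ℤ) y => ((-1 : K) ^ p) • y) ?_ ((hop _).trans ?_)
      · refine (congrArg₂ _ (Fin.sum_univ_two _) (Fin.sum_univ_two _)).trans ?_
        simp [Composition.pair, Composition.length, Composition.blocksFun, Composition.sizeUpTo,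
          hk.2.le]
      · exact congrArg₂ A.mul (congrArg (φ.f k) (funext fun i => congrArg a (zero_add _)))
          (congrArg (φ.f (n - k)) (funext fun i => rfl))
  · intro c hc
    rw [A.higher _ hc, zero_apply, smul_zero]

namespace DGAlg.GradedRetract

open HomotopyRetract Finset

variable {K : Type} [Field K] {A : DGAlg K} (R : A.GradedRetract)

/-- The space of chosen representatives of cohomology classes. -/
noncomputable def cohomology : GVS K where
  carrier := LinearMap.range R.proj
  grading n := (A.V.grading n).comap (LinearMap.range R.proj).subtype
  decomp := by
    let _ := A.V.decomp
    let P := LinearMap.range R.proj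
    have hind := (DirectSum.Decomposition.isInternal A.V.grading).submodule_iSupIndep
    have htop := (DirectSum.Decomposition.isInternal A.V.grading).submodule_iSup_eq_top
    refine DirectSum.IsInternal.chooseDecomposition _
      ((DirectSum.isInternal_submodule_iff_iSupIndep_and_iSup_eq_top _).2 ⟨fun n => ?_, ?_⟩)
    · rw [Submodule.disjoint_def]
      intro x hx hx'
      have h1 : (x : A.V.carrier) ∈ ⨆ (m : ℤ) (_ : m ≠ n), A.V.grading m := by
        have h2 := Submodule.mem_map_of_mem (f := P.subtype) hx'
        rw [Submodule.map_iSup] at h2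
        refine (iSup_mono fun m => ?_ : _ ≤ ⨆ (m : ℤ) (_ : m ≠ n), A.V.grading m) h2
        rw [Submodule.map_iSup]
        exact iSup_mono fun _ => Submodule.map_comap_le _ _
      exact Subtype.ext (Submodule.disjoint_def.1 (hind n) _ hx h1)
    · have h1 : Submodule.map R.proj.rangeRestrict ⊤ = ⊤ := by
        rw [Submodule.map_top, LinearMap.range_rangeRestrict]
      rw [eq_top_iff, ← h1, ← htop, Submodule.map_iSup]
      refine iSup_mono fun n => ?_
      rintro _ ⟨x, hx, rfl⟩
      exact R.proj_mem hx

/-- The cohomology with zero operations. -/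
noncomputable def trivialAlg : DGAlg K where
  V := R.cohomology
  str := { op := fun _ => 0, op_degree := fun _ _ _ _ => zero_mem _ }
  stasheff n _ e a _ := by simp
  higher _ _ := rfl

/-- The inclusion of the chosen representatives. -/
noncomputable def incl : R.cohomology.carrier →ₗ[K] A.V.carrier :=
  (LinearMap.range R.proj).subtype

theorem incl_mem {n : ℤ} {x : R.cohomology.carrier} (hx : x ∈ R.cohomology.grading n) :
    R.incl x ∈ A.V.grading n := hx

theorem proj_incl (x : R.cohomology.carrier) : R.proj (R.incl x) = R.incl x := by
  obtain ⟨_, y, rfl⟩ := x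
  exact R.proj_proj y

theorem extendZero_mem {n : ℕ} {e : Fin n → ℤ} {v : Fin n → A.V.carrier}
    (hv : ∀ i, v i ∈ A.V.grading (e i)) (j : ℕ) :
    extendZero v j ∈ A.V.grading (extendZero e j) := by
  rw [extendZero, extendZero]
  split_ifs
  · exact hv _
  · exact zero_mem _

theorem sgn_pow_of_mem {n : ℤ} {x : A.V.carrier} (hx : x ∈ A.V.grading n) (k : ℕ) :
    (A.V.sgn ^ k) x = (((-1 : K) ^ n) ^ k) • x := by
  induction k with
  | zero => simp
  | succ k ih =>
    rw [pow_succ', Module.End.mul_apply, ih, map_smul, A.V.sgn_of_mem hx, smul_smul, pow_succ]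

/-- The multilinear maps including the cohomology into the dg-algebra. -/
noncomputable def homMap (n : ℕ) :
    MultilinearMap K (fun _ : Fin n => R.cohomology.carrier) A.V.carrier :=
  ((-1 : K) ^ ((n : ℤ) - 1)) • (R.ofCohMultilinear n).compLinearMap
    fun i => (A.V.sgn ^ (n - 1 - (i : ℕ))) ∘ₗ R.incl

/-- The exponent of the sign relating `homMap` to `ofCoh`. -/
def homSign (n : ℕ) (e : ℕ → ℤ) : ℤ :=
  ((n : ℤ) - 1) + ∑ i ∈ range n, ((n : ℤ) - 1 - i) * e i

theorem prod_zpow_range (n : ℕ) (f : ℕ → ℤ) :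
    ∏ i ∈ range n, (-1 : K) ^ f i = (-1 : K) ^ ∑ i ∈ range n, f i := by
  induction n with
  | zero => simp
  | succ n ih => rw [prod_range_succ, ih, sum_range_succ, zpow_add₀ (by simp)]

theorem homMap_apply (n : ℕ) {e : ℕ → ℤ} {a : ℕ → R.cohomology.carrier}
    (ha : ∀ i, a i ∈ R.cohomology.grading (e i)) :
    R.homMap n (fun j => a j) =
      ((-1 : K) ^ homSign n e) • R.ofCoh n fun j => R.incl (a j) := by
  have h1 (i : Fin n) : ((A.V.sgn ^ (n - 1 - (i : ℕ))) ∘ₗ R.incl) (a i) =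
      ((-1 : K) ^ (((n : ℤ) - 1 - (i : ℕ)) * e i)) • R.incl (a i) := by
    refine (sgn_pow_of_mem (R.incl_mem (ha i)) _).trans ?_
    rw [← zpow_natCast, ← zpow_mul, mul_comm]
    congr 3
    omega
  rw [homMap, smul_apply, MultilinearMap.compLinearMap_apply]
  simp only [h1]
  rw [MultilinearMap.map_smul_univ, R.ofCohMultilinear_apply n fun j => R.incl (a j), smul_smul,
    homSign, zpow_add₀ (by simp), ← prod_zpow_range,
    Fin.prod_univ_eq_prod_range fun i : ℕ => (-1 : K) ^ (((n : ℤ) - 1 - i) * e i)]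

theorem homSign_add {n k : ℕ} (hk : k ≤ n) (e : ℕ → ℤ) :
    homSign n e = homSign k e + homSign (n - k) (fun i => e (k + i)) +
      ((n : ℤ) - k) * ∑ i ∈ range k, e i + 1 := by
  obtain ⟨l, rfl⟩ := Nat.exists_eq_add_of_le hk
  have h1 : ∑ i ∈ range k, (((k + l : ℕ) : ℤ) - 1 - i) * e i =
      ∑ i ∈ range k, ((k : ℤ) - 1 - i) * e i + (l : ℤ) * ∑ i ∈ range k, e i := by
    rw [mul_sum, ← sum_add_distrib]
    exact sum_congr rfl fun i _ => by push_cast; ring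
  have h2 : ∑ i ∈ range l, (((k + l : ℕ) : ℤ) - 1 - (k + i : ℕ)) * e (k + i) =
      ∑ i ∈ range l, ((l : ℤ) - 1 - i) * e (k + i) :=
    sum_congr rfl fun i _ => by push_cast; ring
  rw [homSign, homSign, homSign, Nat.add_sub_cancel_left, sum_range_add, h1, h2]
  push_cast
  ring

theorem neg_one_zpow_of_odd_sub {p q : ℤ} (h : Odd (p - q)) :
    (-1 : K) ^ p = -(-1 : K) ^ q := by
  rw [← sub_add_cancel p q, zpow_add₀ (by simp), h.neg_one_zpow, neg_one_mul]

/-- The inclusion of the cohomology into the dg-algebra with its higher corrections. -/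
noncomputable def hom : AInftyHomData K R.cohomology A.V where
  f := R.homMap
  f_degree n e a ha := by
    refine Submodule.smul_mem _ _ ?_
    have h1 := R.ofCoh_mem (extendZero_mem (e := e)
      (v := fun i => (A.V.sgn ^ (n - 1 - (i : ℕ))) (R.incl (a i))) fun i => ?_) n
    · have h2 : mDeg (extendZero e) 0 n = ∑ i, e i + (1 - (n : ℤ)) := by
        rw [mDeg, ← range_eq_Ico, ← Fin.sum_univ_eq_sum_range]
        simp [extendZero]
        ring
      rw [← h2]
      exact h1
    · rw [sgn_pow_of_mem (R.incl_mem (ha i))]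
      exact Submodule.smul_mem _ _ (R.incl_mem (ha i))

theorem isAInftyMorphism_hom
    (h : ∀ n, 1 ≤ n → ∀ (e : ℕ → ℤ) (x : ℕ → A.V.carrier), (∀ i, x i ∈ A.V.grading (e i)) →
      (∀ i, R.proj (x i) = x i) → R.d (R.ofCoh n x) = R.masseySum (R.ofCohMatrix x) 0 n) :
    IsAInftyMorphism R.hom R.trivialAlg.str A.str := by
  intro n hn e a ha
  rw [R.hom.sum_composition hn]
  refine Eq.trans (sum_eq_zero fun r _ => sum_eq_zero fun s _ => ?_) (Eq.symm ?_)
  · refine smul_eq_zero_of_right _ ((R.homMap _).map_coord_zero ⟨r, by omega⟩ ?_)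
    simp [trivialAlg]
  · have hx (i : ℕ) := R.incl_mem (ha i)
    have hd := h n hn e (fun i => R.incl (a i)) hx fun i => R.proj_incl _
    rw [R.masseySum_eq e fun k hk => R.ofCohMatrix_mem hx (mem_Ioo.1 hk).1, R.d_eq] at hd
    have hf (k r : ℕ) : R.hom.f k (fun i => a (r + i)) =
        ((-1 : K) ^ homSign k fun i => e (r + i)) • R.ofCoh k fun i => R.incl (a (r + i)) :=
      R.homMap_apply k fun i => ha (r + i)
    have hf0 (k : ℕ) : R.hom.f k (fun i => a i) =
        ((-1 : K) ^ homSign k e) • R.ofCoh k fun i => R.incl (a i) :=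
      R.homMap_apply k ha
    rw [hf0, ← dLin_apply, map_smul, dLin_apply, hd, smul_sum, ← sum_add_distrib]
    refine sum_eq_zero fun k hk => ?_
    have hk' := mem_Ioo.1 hk
    rw [hf0, hf, ofCohMatrix_zero, ofCohMatrix]
    simp only [← mulLin_apply, map_smul, LinearMap.smul_apply, smul_smul]
    rw [← zpow_add₀ (by simp), ← zpow_add₀ (by simp), ← zpow_add₀ (by simp),
      neg_one_zpow_of_odd_sub (K := K)
      (q := (k : ℤ) - 1 + (1 - ((n : ℤ) - k)) * ∑ i ∈ range k, e i +
        (homSign (n - k) (fun i => e (k + i)) + homSign k e)), neg_smul, neg_add_cancel]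
    rw [homSign_add hk'.2.le, mDeg, ← range_eq_Ico]
    refine ⟨((n : ℤ) - k) * ∑ i ∈ range k, e i - k + 1, ?_⟩
    push_cast
    ring

theorem isQuasiIso_hom : R.hom.IsQuasiIso R.trivialAlg.str A.str := by
  have hf (x : R.cohomology.carrier) : R.hom.f1 x = R.incl x := by
    change R.homMap 1 (fun _ => x) = R.incl x
    simp [homMap, ofCohMultilinear, ofCoh, extendZero]
  refine ⟨fun x _ ⟨c, hc⟩ => ⟨0, ?_⟩, fun y hy => ?_⟩
  · rw [hf] at hc
    refine (?_ : x = 0)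
    refine Subtype.ext ?_
    have h1 := R.proj_d c
    rw [R.d_eq] at h1
    exact (R.proj_incl x).symm.trans ((congrArg R.proj hc).trans h1)
  · let x : R.cohomology.carrier := R.proj.rangeRestrict y
    have h1 := R.homotopy y
    rw [R.d_eq y, DGAlg.d, hy, map_zero, add_zero, R.d_eq] at h1
    exact ⟨x, rfl, R.h y, (congrArg (y - ·) (hf x)).trans h1.symm⟩

end DGAlg.GradedRetract

/-- If the induced product on the cohomology of a dg-algebra `A`
over a field of characteristic `0` is identically zero (every product of cocycles
is a coboundary) and every defined Massey `n`-product (`n ≥ 3`) on `A` vanishes,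
then `A` is formal. -/
theorem formal_of_trivial_product_and_vanishing_massey
    (K : Type) [Field K] [CharZero K] (A : DGAlg K)
    (hprod : ∀ x y, A.d x = 0 → A.d y = 0 → ∃ c, A.mul x y = A.d c)
    (hmassey : ∀ n, 3 ≤ n → ∀ (dg : ℕ → ℤ) (u : ℕ → A.V.carrier),
      ValidReps A n dg u → MasseyDefined A n dg u → MasseyVanishes A n dg u) :
    A.IsFormal := by
  obtain ⟨R⟩ := A.nonempty_gradedRetract
  exact ⟨R.trivialAlg, fun _ => rfl, R.hom,
    R.isAInftyMorphism_hom fun n hn => (R.isClosedAt_and_d_ofCoh hprod hmassey hn).2,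
    R.isQuasiIso_hom⟩
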